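/- arXiv:1810.03112 — 2 statements merged into one kernel-verified Lean document; each statement's English description precedes it below -/
import Mathlib

section
/- Let z ∈ ℂ with Im z ≠ 0. If θ₁ and θ₂ both solve the Schrödinger equation with spectral parameter z on [0,∞) and θⱼ(x)/a(x,z) → 1 as x → ∞ for j = 1, 2, then θ₁(x) = θ₂(x) for all x ≥ 0. -/
open MeasureTheory Filter Set Complex

noncomputable section

/-- The principal-branch square root `ω(x,z) = ((q x − z)/p x)^{1/2}`. -/
def omg (p q : ℝ → ℝ) (z : ℂ) (x : ℝ) : ℂ :=
  (((q x : ℂ) - z) / (p x : ℂ)) ^ (1 / 2 : ℂ)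

/-- `Ω(x,z) = ∫₀ˣ ω(y,z) dy`. -/
def Omg (p q : ℝ → ℝ) (z : ℂ) (x : ℝ) : ℂ :=
  ∫ y in (0:ℝ)..x, omg p q z y

/-- `a(x,z) = exp(−Ω(x,z))`. -/
def aa (p q : ℝ → ℝ) (z : ℂ) (x : ℝ) : ℂ :=
  Complex.exp (-(Omg p q z x))

/-- Assumption (PQ): `p > 0` on `[0,∞)`, locally absolutely continuous with integrable
derivative `p'` and limit `p₀ > 0` at `+∞`; `q` integrable on `(0,x₀)`, locally absolutely
continuous on `[x₀,∞)` with integrable derivative `q'` there, and `q → 0` at `+∞`.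
Absolute continuity is encoded by the fundamental theorem of calculus representation. -/
structure PQData (p p' q q' : ℝ → ℝ) (p₀ x₀ : ℝ) : Prop where
  p_pos : ∀ x : ℝ, 0 ≤ x → 0 < p x
  hp₀ : 0 < p₀
  hx₀ : 0 ≤ x₀
  p_ac : ∀ x : ℝ, 0 ≤ x → p x = p 0 + ∫ t in (0:ℝ)..x, p' t
  p'_int : IntegrableOn p' (Ioi (0:ℝ))
  p_lim : Tendsto p atTop (nhds p₀)
  q_int : IntegrableOn q (Ioo (0:ℝ) x₀)
  q_ac : ∀ x : ℝ, x₀ ≤ x → q x = q x₀ + ∫ t in x₀..x, q' t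
  q'_int : IntegrableOn q' (Ioi x₀)
  q_lim : Tendsto q atTop (nhds (0:ℝ))

/-- `f` (with derivative `f'`) solves `−(p f')' + q f = z f` on `I`:
`f` is differentiable on `I` with derivative `f'`, and `p·f'` is locally absolutely
continuous on `I` with a.e. derivative `(q − z)·f` (encoded via the FTC representation). -/
def IsSol (p q : ℝ → ℝ) (z : ℂ) (I : Set ℝ) (f f' : ℝ → ℂ) : Prop :=
  (∀ x ∈ I, HasDerivWithinAt f (f' x) I x) ∧
    ∀ x ∈ I, ∀ y ∈ I,
      (p y : ℂ) * f' y - (p x : ℂ) * f' x = ∫ t in x..y, ((q t : ℂ) - z) * f t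

/-- `ε(x) = ∫ₓ^∞ (|p'| + |q'|)`. -/
def eps (p' q' : ℝ → ℝ) (x : ℝ) : ℝ :=
  ∫ y in Ioi x, (|p' y| + |q' y|)

/-- The Volterra kernel `G(x,y,z) = a(y,z)² ∫ₓ^y p(s)⁻¹ a(s,z)⁻² ds`. -/
def Gker (p q : ℝ → ℝ) (z : ℂ) (x y : ℝ) : ℂ :=
  aa p q z y ^ 2 * ∫ s in x..y, ((p s : ℂ))⁻¹ * (aa p q z s ^ 2)⁻¹

/-- `Φ(x,λ) = ∫₀ˣ √(max((λ − q)/p, 0))`. -/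
def Phi (p q : ℝ → ℝ) (lam x : ℝ) : ℝ :=
  ∫ y in (0:ℝ)..x, Real.sqrt (max ((lam - q y) / p y) 0)

/-- `K(λ) = exp(−∫₀^∞ √(max((q − λ)/p, 0)))`. -/
def Kc (p q : ℝ → ℝ) (lam : ℝ) : ℝ :=
  Real.exp (-∫ y in Ioi (0:ℝ), Real.sqrt (max ((q y - lam) / p y) 0))

/-- `ξ(x) = θ(x)·∫_ϱ^x θ(y)⁻² p(y)⁻¹ dy`. -/
def xiFun (p : ℝ → ℝ) (θ : ℝ → ℂ) (ϱ x : ℝ) : ℂ :=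
  θ x * ∫ y in ϱ..x, (θ y ^ 2)⁻¹ * ((p y : ℂ))⁻¹

/-- The derivative of `ξ`: `ξ'(x) = θ'(x)·∫_ϱ^x θ⁻² p⁻¹ + θ(x)⁻¹ p(x)⁻¹`. -/
def xiFun' (p : ℝ → ℝ) (θ θ' : ℝ → ℂ) (ϱ x : ℝ) : ℂ :=
  θ' x * (∫ y in ϱ..x, (θ y ^ 2)⁻¹ * ((p y : ℂ))⁻¹) + (θ x)⁻¹ * ((p x : ℂ))⁻¹

lemma ac_const (c : ℂ) (a b : ℝ) : AbsolutelyContinuousOnInterval (fun _ : ℝ => c) a b :=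
  (LipschitzWith.const c).lipschitzOnWith.absolutelyContinuousOnInterval

lemma ac_integral {φ : ℝ → ℂ} {a b : ℝ} (h : IntervalIntegrable φ volume a b) :
    AbsolutelyContinuousOnInterval (fun x => ∫ t in a..x, φ t) a b := by
  have hre : IntervalIntegrable (fun t => (φ t).re) volume a b :=
    ⟨h.1.re, h.2.re⟩
  have him : IntervalIntegrable (fun t => (φ t).im) volume a b :=
    ⟨h.1.im, h.2.im⟩
  have h1 := (hre.absolutelyContinuousOnInterval_intervalIntegral (c := a) (by simp)).fun_smul
    (ac_const 1 a b)
  have h2 := (him.absolutelyContinuousOnInterval_intervalIntegral (c := a) (by simp)).fun_smul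
    (ac_const I a b)
  have h3 := h1.fun_add h2
  have key : ∀ x ∈ uIcc a b, (∫ t in a..x, φ t) =
      (∫ t in a..x, (φ t).re) • (1:ℂ) + (∫ t in a..x, (φ t).im) • I := by
    intro x hx
    have hi : IntervalIntegrable φ volume a x := h.mono_set (uIcc_subset_uIcc_left hx)
    have e1 : (∫ t in a..x, (φ t).re) = (∫ t in a..x, φ t).re :=
      Complex.reCLM.intervalIntegral_comp_comm hi
    have e2 : (∫ t in a..x, (φ t).im) = (∫ t in a..x, φ t).im :=
      Complex.imCLM.intervalIntegral_comp_comm hi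
    rw [e1, e2]
    simp [Complex.re_add_im]
  rw [absolutelyContinuousOnInterval_iff] at h3 ⊢
  intro ε hε
  obtain ⟨δ, hδ, H⟩ := h3 ε hε
  refine ⟨δ, hδ, fun E hE hs => ?_⟩
  have := H E hE hs
  refine lt_of_eq_of_lt (Finset.sum_congr rfl fun i hi => ?_) this
  have := hE.1 i hi
  rw [key _ this.1, key _ this.2]

lemma lag {f g φ γ : ℝ → ℂ} {a b : ℝ} (hab : a ≤ b)
    (hφ : IntervalIntegrable φ volume a b) (hγ : IntervalIntegrable γ volume a b)
    (hf : ∀ t ∈ Icc a b, f t - f a = ∫ s in a..t, φ s)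
    (hg : ∀ t ∈ Icc a b, g t - g a = ∫ s in a..t, γ s) :
    IntervalIntegrable (fun t => φ t * g t + f t * γ t) volume a b ∧
    f b * g b - f a * g a = ∫ t in a..b, (φ t * g t + f t * γ t) := by
  set F : ℝ → ℂ := fun x => f a + ∫ s in a..x, φ s with hF
  set G : ℝ → ℂ := fun x => g a + ∫ s in a..x, γ s with hG
  have hFac : AbsolutelyContinuousOnInterval F a b := (ac_const (f a) a b).fun_add (ac_integral hφ)
  have hGac : AbsolutelyContinuousOnInterval G a b := (ac_const (g a) a b).fun_add (ac_integral hγ)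
  have hFf : ∀ t ∈ Icc a b, f t = F t := fun t ht => by
    simp only [hF]; rw [← hf t ht]; ring
  have hGg : ∀ t ∈ Icc a b, g t = G t := fun t ht => by
    simp only [hG]; rw [← hg t ht]; ring
  have hint : IntervalIntegrable (fun t => φ t * G t + F t * γ t) volume a b :=
    (hφ.mul_continuousOn hGac.continuousOn).add (hγ.continuousOn_mul hFac.continuousOn)
  have hcongr : ∀ t ∈ uIcc a b, φ t * G t + F t * γ t = φ t * g t + f t * γ t := by
    intro t ht
    rw [uIcc_of_le hab] at ht
    rw [hFf t ht, hGg t ht]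
  have hH : AbsolutelyContinuousOnInterval
      (fun x => F x • G x - ∫ t in a..x, (φ t * G t + F t * γ t)) a b :=
    (hFac.fun_smul hGac).fun_sub (ac_integral hint)
  obtain ⟨C, hC⟩ := hH.const_of_ae_hasDerivAt_zero (by
    filter_upwards [hφ.ae_hasDerivAt_integral, hγ.ae_hasDerivAt_integral,
      hint.ae_hasDerivAt_integral] with x h1 h2 h3 hx
    have d1 : HasDerivAt F (φ x) x := (h1 hx a (by simp)).const_add (f a)
    have d2 : HasDerivAt G (γ x) x := (h2 hx a (by simp)).const_add (g a)
    have d3 := (d1.fun_mul d2).fun_sub (h3 hx a (by simp))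
    simpa using d3)
  have ca := hC a (by simp)
  have cb := hC b (by simp)
  simp only [intervalIntegral.integral_same, smul_eq_mul, sub_zero] at ca cb
  refine ⟨hint.congr (fun t ht => hcongr t (uIoc_subset_uIcc ht)), ?_⟩
  rw [← intervalIntegral.integral_congr hcongr, hFf a (by simp [hab]), hFf b (by simp [hab]),
    hGg a (by simp [hab]), hGg b (by simp [hab]), ca, ← cb]
  ring

lemma cont_of_integral {E : Type*} [NormedAddCommGroup E] [NormedSpace ℝ E] [CompleteSpace E]
    {f φ : ℝ → E} {a : ℝ} (hφ : ∀ b, a ≤ b → IntervalIntegrable φ volume a b)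
    (h : ∀ t, a ≤ t → f t = f a + ∫ s in a..t, φ s) : ContinuousOn f (Ici a) := by
  intro x hx
  have hx' : a ≤ x := hx
  have h1 : ContinuousOn (fun t => f a + ∫ s in a..t, φ s) (uIcc a (x+1)) :=
    continuousOn_const.add
      (intervalIntegral.continuousOn_primitive_interval' (hφ (x+1) (by linarith)) (by simp))
  rw [uIcc_of_le (by linarith)] at h1
  have h2 : ContinuousOn f (Icc a (x+1)) := h1.congr fun t ht => h t ht.1
  refine (h2 x ⟨hx', by linarith⟩).mono_of_mem_nhdsWithin ?_
  rw [← Ici_inter_Iic]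
  exact inter_mem_nhdsWithin _ (Iic_mem_nhds (by linarith))

section
variable {p p' q q' : ℝ → ℝ} {p₀ x₀ : ℝ}

lemma p_cont (hPQ : PQData p p' q q' p₀ x₀) : ContinuousOn p (Ici 0) :=
  cont_of_integral (φ := p') (fun b hb => by
    rw [intervalIntegrable_iff_integrableOn_Ioc_of_le hb]
    exact hPQ.p'_int.mono_set Ioc_subset_Ioi_self) hPQ.p_ac

lemma q_cont (hPQ : PQData p p' q q' p₀ x₀) : ContinuousOn q (Ici x₀) :=
  cont_of_integral (φ := q') (fun b hb => by
    rw [intervalIntegrable_iff_integrableOn_Ioc_of_le hb]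
    exact hPQ.q'_int.mono_set Ioc_subset_Ioi_self) hPQ.q_ac

lemma q_ii0 (hPQ : PQData p p' q q' p₀ x₀) (b : ℝ) (hb : 0 ≤ b) :
    IntervalIntegrable q volume 0 b := by
  have h1 : IntervalIntegrable q volume 0 x₀ := by
    rw [intervalIntegrable_iff_integrableOn_Ioo_of_le hPQ.hx₀]
    exact hPQ.q_int
  have h2 : IntervalIntegrable q volume x₀ (max x₀ b) := by
    apply ContinuousOn.intervalIntegrable
    rw [uIcc_of_le (le_max_left _ _)]
    exact (q_cont hPQ).mono Icc_subset_Ici_self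
  refine (h1.trans h2).mono_set ?_
  rw [uIcc_of_le hb, uIcc_of_le (hPQ.hx₀.trans (le_max_left _ _))]
  exact Icc_subset_Icc_right (le_max_right _ _)

lemma q_ii (hPQ : PQData p p' q q' p₀ x₀) {a b : ℝ} (ha : 0 ≤ a) (hb : 0 ≤ b) :
    IntervalIntegrable q volume a b :=
  (q_ii0 hPQ a ha).symm.trans (q_ii0 hPQ b hb)

lemma uIcc_sub {a b : ℝ} (ha : 0 ≤ a) (hb : 0 ≤ b) : uIcc a b ⊆ Ici 0 := by
  intro t ht
  exact (le_min ha hb).trans ht.1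

lemma sol_k_ii (hPQ : PQData p p' q q' p₀ x₀) {z : ℂ} {f f' : ℝ → ℂ}
    (h : IsSol p q z (Ici 0) f f') {a b : ℝ} (ha : 0 ≤ a) (hb : 0 ≤ b) :
    IntervalIntegrable (fun t => ((q t : ℂ) - z) * f t) volume a b := by
  have hq : IntervalIntegrable (fun t => (q t : ℂ)) volume a b :=
    ⟨(q_ii hPQ ha hb).1.ofReal, (q_ii hPQ ha hb).2.ofReal⟩
  have hf : ContinuousOn f (Ici 0) := fun x hx => (h.1 x hx).continuousWithinAt
  exact (hq.sub intervalIntegrable_const).mul_continuousOn (hf.mono (uIcc_sub ha hb))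

lemma sol_u_cont (hPQ : PQData p p' q q' p₀ x₀) {z : ℂ} {f f' : ℝ → ℂ}
    (h : IsSol p q z (Ici 0) f f') : ContinuousOn (fun t => (p t : ℂ) * f' t) (Ici 0) :=
  cont_of_integral (fun b hb => sol_k_ii hPQ h le_rfl hb) (fun t ht => by
    rw [← h.2 0 (by simp) t ht]; ring)

lemma sol_f'_cont (hPQ : PQData p p' q q' p₀ x₀) {z : ℂ} {f f' : ℝ → ℂ}
    (h : IsSol p q z (Ici 0) f f') : ContinuousOn f' (Ici 0) := by
  have h1 : ContinuousOn (fun t => (p t : ℂ)) (Ici 0) :=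
    Complex.continuous_ofReal.comp_continuousOn (p_cont hPQ)
  have hne : ∀ t ∈ Ici (0:ℝ), (p t : ℂ) ≠ 0 := fun t ht =>
    Complex.ofReal_ne_zero.2 (hPQ.p_pos t ht).ne'
  refine ((sol_u_cont hPQ h).div h1 hne).congr fun t ht => ?_
  have := hne t ht
  simp only [Pi.div_apply]
  field_simp

lemma sol_ftc (hPQ : PQData p p' q q' p₀ x₀) {z : ℂ} {f f' : ℝ → ℂ}
    (h : IsSol p q z (Ici 0) f f') {a b : ℝ} (ha : 0 ≤ a) (hab : a ≤ b) :
    IntervalIntegrable f' volume a b ∧ f b - f a = ∫ t in a..b, f' t := by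
  have hi : IntervalIntegrable f' volume a b :=
    ((sol_f'_cont hPQ h).mono (uIcc_sub ha (ha.trans hab))).intervalIntegrable
  refine ⟨hi, (intervalIntegral.integral_eq_sub_of_hasDerivAt_of_le hab ?_ ?_ hi).symm⟩
  · exact fun x hx => (h.1 x (ha.trans hx.1)).continuousWithinAt.mono
      (fun t ht => ha.trans ht.1)
  · exact fun x hx => (h.1 x (ha.trans hx.1.le)).hasDerivAt
      (Ici_mem_nhds (lt_of_le_of_lt ha hx.1))

lemma wronski (hPQ : PQData p p' q q' p₀ x₀) {z : ℂ} {f f' g g' : ℝ → ℂ}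
    (hf : IsSol p q z (Ici 0) f f') (hg : IsSol p q z (Ici 0) g g')
    {a b : ℝ} (ha : 0 ≤ a) (hab : a ≤ b) :
    f b * (p b * g' b) - g b * (p b * f' b) = f a * (p a * g' a) - g a * (p a * f' a) := by
  have hb := ha.trans hab
  have h1 := lag (f := f) (g := fun t => (p t : ℂ) * g' t) hab (sol_ftc hPQ hf ha hab).1
    (sol_k_ii hPQ hg ha hb)
    (fun t ht => (sol_ftc hPQ hf ha ht.1).2) (fun t ht => hg.2 a ha t (ha.trans ht.1))
  have h2 := lag (f := g) (g := fun t => (p t : ℂ) * f' t) hab (sol_ftc hPQ hg ha hab).1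
    (sol_k_ii hPQ hf ha hb)
    (fun t ht => (sol_ftc hPQ hg ha ht.1).2) (fun t ht => hf.2 a ha t (ha.trans ht.1))
  have h3 : (∫ t in a..b, (f' t * ((p t : ℂ) * g' t) + f t * (((q t : ℂ) - z) * g t))) =
      ∫ t in a..b, (g' t * ((p t : ℂ) * f' t) + g t * (((q t : ℂ) - z) * f t)) := by
    congr 1; ext t; ring
  have e1 := h1.2
  have e2 := h2.2
  rw [h3, ← e2] at e1
  linear_combination e1

lemma green (hPQ : PQData p p' q q' p₀ x₀) {z : ℂ} {f f' : ℝ → ℂ}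
    (hf : IsSol p q z (Ici 0) f f') {a b : ℝ} (ha : 0 ≤ a) (hab : a ≤ b) :
    ((starRingEnd ℂ) (f b) * (p b * f' b)).im - ((starRingEnd ℂ) (f a) * (p a * f' a)).im
      = -z.im * ∫ t in a..b, ‖f t‖ ^ 2 := by
  have hb := ha.trans hab
  have hc : ∀ t, a ≤ t → t ≤ b → (starRingEnd ℂ) (f t) - (starRingEnd ℂ) (f a) =
      ∫ s in a..t, (starRingEnd ℂ) (f' s) := by
    intro t h1 h2
    rw [← map_sub, (sol_ftc hPQ hf ha h1).2]
    exact (Complex.conjCLE.toContinuousLinearMap.intervalIntegral_comp_comm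
      (sol_ftc hPQ hf ha h1).1).symm
  have hci : IntervalIntegrable (fun s => (starRingEnd ℂ) (f' s)) volume a b :=
    (Complex.continuous_conj.comp_continuousOn
      ((sol_f'_cont hPQ hf).mono (uIcc_sub ha hb))).intervalIntegrable
  have h1 := lag (f := fun t => (starRingEnd ℂ) (f t)) (g := fun t => (p t : ℂ) * f' t) hab hci
    (sol_k_ii hPQ hf ha hb)
    (fun t ht => hc t ht.1 ht.2) (fun t ht => hf.2 a ha t (ha.trans ht.1))
  have e := congrArg Complex.im h1.2
  rw [Complex.sub_im] at e
  rw [e, ← intervalIntegral.integral_const_mul]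
  refine (Complex.imCLM.intervalIntegral_comp_comm h1.1).symm.trans ?_
  congr 1
  ext t
  rw [Complex.sq_norm, Complex.normSq_apply]
  simp
  ring

lemma sqrt_re_pos {w : ℂ} (hw : w.im ≠ 0) : 0 < (w ^ (1 / 2 : ℂ)).re := by
  have h0 : w ≠ 0 := by rintro rfl; simp at hw
  rw [Complex.cpow_def_of_ne_zero h0, Complex.exp_re]
  apply mul_pos (Real.exp_pos _)
  have : (Complex.log w * (1/2 : ℂ)).im = w.arg / 2 := by
    rw [show (1/2 : ℂ) = ((1/2 : ℝ) : ℂ) by norm_num, Complex.im_mul_ofReal, Complex.log_im]; ring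
  rw [this]
  have h1 := Complex.neg_pi_lt_arg w
  have h2 := Complex.arg_lt_pi_iff.2 (Or.inr hw)
  apply Real.cos_pos_of_mem_Ioo
  constructor <;> linarith

lemma omg_ii (hPQ : PQData p p' q q' p₀ x₀) (z : ℂ) {a b : ℝ} (ha : 0 ≤ a) (hb : 0 ≤ b) :
    IntervalIntegrable (omg p q z) volume a b := by
  have hq : IntervalIntegrable (fun t => (q t : ℂ)) volume a b :=
    ⟨(q_ii hPQ ha hb).1.ofReal, (q_ii hPQ ha hb).2.ofReal⟩
  have h1 : ContinuousOn (fun t => ((p t : ℂ))⁻¹) (uIcc a b) :=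
    ((Complex.continuous_ofReal.comp_continuousOn (p_cont hPQ)).inv₀ (fun t ht =>
      Complex.ofReal_ne_zero.2 (hPQ.p_pos t ht).ne')).mono (uIcc_sub ha hb)
  have h2 : IntervalIntegrable (fun t => ((q t : ℂ) - z) / (p t : ℂ)) volume a b :=
    (hq.sub intervalIntegrable_const).mul_continuousOn h1
  have h3 : IntervalIntegrable (fun t => 1 + ‖((q t : ℂ) - z) / (p t : ℂ)‖) volume a b :=
    intervalIntegrable_const.add h2.norm
  rw [intervalIntegrable_iff] at h2 h3 ⊢
  refine Integrable.mono' h3 ?_ (Eventually.of_forall fun t => ?_)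
  · have := h2.aestronglyMeasurable.aemeasurable
    exact (this.pow_const _).aestronglyMeasurable
  · unfold omg
    rw [show (1/2 : ℂ) = ((1/2 : ℝ) : ℂ) by norm_num, Complex.norm_cpow_real, ← Real.sqrt_eq_rpow]
    rw [Real.sqrt_le_left (by positivity)]
    nlinarith [norm_nonneg (((q t : ℂ) - z) / (p t : ℂ))]

lemma aa_decay (hPQ : PQData p p' q q' p₀ x₀) (z : ℂ) (hz : z.im ≠ 0) :
    ∃ c > 0, ∃ C > 0, ∀ᶠ x in atTop, ‖aa p q z x‖ ≤ C * Real.exp (-c * x) := by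
  set w : ℂ := ((0:ℝ) - z) / (p₀ : ℂ) with hw
  have hwim : w.im ≠ 0 := by
    rw [hw, Complex.div_ofReal_im]
    simp [hz, hPQ.hp₀.ne']
  have hlim : Tendsto (fun x => ((q x : ℂ) - z) / (p x : ℂ)) atTop (nhds w) := by
    apply Tendsto.div
    · exact ((Complex.continuous_ofReal.tendsto _).comp hPQ.q_lim).sub_const z
    · exact (Complex.continuous_ofReal.tendsto _).comp hPQ.p_lim
    · exact Complex.ofReal_ne_zero.2 hPQ.hp₀.ne'
  have hom : Tendsto (fun x => (omg p q z x).re) atTop (nhds (w ^ (1/2 : ℂ)).re) :=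
    (Complex.continuous_re.tendsto _).comp
      ((continuousAt_cpow_const (Or.inr hwim)).tendsto.comp hlim)
  set r := (w ^ (1/2 : ℂ)).re with hr
  have hrpos : 0 < r := sqrt_re_pos hwim
  obtain ⟨X, hX⟩ := eventually_atTop.1
    ((hom.eventually (lt_mem_nhds (half_lt_self hrpos))).and (eventually_ge_atTop 0))
  have hX0 : 0 ≤ X := (hX X le_rfl).2
  refine ⟨r / 2, by positivity, Real.exp (-(Omg p q z X).re + r / 2 * X), Real.exp_pos _, ?_⟩
  filter_upwards [eventually_ge_atTop X] with x hx
  rw [aa, Complex.norm_exp, ← Real.exp_add, Real.exp_le_exp, Complex.neg_re]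
  have hx0 := hX0.trans hx
  have e : Omg p q z x = Omg p q z X + ∫ t in X..x, omg p q z t :=
    (intervalIntegral.integral_add_adjacent_intervals (omg_ii hPQ z le_rfl hX0)
      (omg_ii hPQ z hX0 hx0)).symm
  have hi := omg_ii hPQ z hX0 hx0
  have e2 : (∫ t in X..x, omg p q z t).re = ∫ t in X..x, (omg p q z t).re :=
    (Complex.reCLM.intervalIntegral_comp_comm hi).symm
  have e3 : (∫ t in X..x, (r/2 : ℝ)) ≤ ∫ t in X..x, (omg p q z t).re :=
    intervalIntegral.integral_mono_on hx intervalIntegrable_const ⟨hi.1.re, hi.2.re⟩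
      fun t ht => (hX t ht.1).1.le
  rw [intervalIntegral.integral_const, smul_eq_mul] at e3
  rw [e, Complex.add_re, e2]
  linarith

lemma sol_decay (hPQ : PQData p p' q q' p₀ x₀) (z : ℂ) (hz : z.im ≠ 0) {f : ℝ → ℂ}
    (hl : Tendsto (fun x => f x / aa p q z x) atTop (nhds 1)) :
    ∃ c > 0, ∃ C > 0, ∀ᶠ x in atTop, ‖f x‖ ≤ C * Real.exp (-c * x) := by
  obtain ⟨c, hc, C, hC, h⟩ := aa_decay hPQ z hz
  refine ⟨c, hc, 2 * C, by positivity, ?_⟩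
  have h1 : ∀ᶠ x in atTop, ‖f x / aa p q z x‖ < 2 :=
    hl.norm.eventually (gt_mem_nhds (by norm_num))
  filter_upwards [h, h1] with x h2 h3
  have : 0 < ‖aa p q z x‖ := norm_pos_iff.2 (Complex.exp_ne_zero _)
  rw [norm_div, div_lt_iff₀ this] at h3
  linarith

lemma sol_u_linear (hPQ : PQData p p' q q' p₀ x₀) (z : ℂ) (hz : z.im ≠ 0) {f f' : ℝ → ℂ}
    (hf : IsSol p q z (Ici 0) f f')
    (hl : Tendsto (fun x => f x / aa p q z x) atTop (nhds 1)) :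
    ∃ A B : ℝ, ∀ᶠ x in atTop, ‖(p x : ℂ) * f' x‖ ≤ A + B * x := by
  obtain ⟨c, hc, C, hC, h⟩ := sol_decay hPQ z hz hl
  have hq : ∀ᶠ x in atTop, ‖(q x : ℂ) - z‖ < ‖((0:ℝ) : ℂ) - z‖ + 1 :=
    ((((Complex.continuous_ofReal.tendsto _).comp hPQ.q_lim).sub_const z).norm).eventually
      (gt_mem_nhds (by linarith))
  obtain ⟨X, hX⟩ := eventually_atTop.1 ((h.and hq).and (eventually_ge_atTop 0))
  have hX0 : 0 ≤ X := (hX X le_rfl).2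
  set K := (‖((0:ℝ) : ℂ) - z‖ + 1) * C with hK
  refine ⟨‖(p X : ℂ) * f' X‖ - K * X, K, ?_⟩
  filter_upwards [eventually_ge_atTop X] with x hx
  have h1 := hf.2 X hX0 x (hX0.trans hx)
  have h2 : ‖∫ t in X..x, ((q t : ℂ) - z) * f t‖ ≤ K * |x - X| := by
    apply intervalIntegral.norm_integral_le_of_norm_le_const
    intro t ht
    rw [uIoc_of_le hx] at ht
    obtain ⟨⟨a1, a2⟩, a3⟩ := hX t ht.1.le
    rw [norm_mul]
    apply mul_le_mul a2.le _ (norm_nonneg _) (by positivity)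
    refine a1.trans (mul_le_of_le_one_right hC.le ?_)
    rw [Real.exp_le_one_iff]
    nlinarith
  rw [abs_of_nonneg (by linarith)] at h2
  have h3 : (p x : ℂ) * f' x = (p X : ℂ) * f' X + ∫ t in X..x, ((q t : ℂ) - z) * f t := by
    rw [← h1]; ring
  rw [h3]
  refine (norm_add_le _ _).trans ?_
  linarith

lemma prod_tendsto (hPQ : PQData p p' q q' p₀ x₀) (z : ℂ) (hz : z.im ≠ 0) {f g g' : ℝ → ℂ}
    (hlf : Tendsto (fun x => f x / aa p q z x) atTop (nhds 1))
    (hg : IsSol p q z (Ici 0) g g')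
    (hlg : Tendsto (fun x => g x / aa p q z x) atTop (nhds 1)) :
    Tendsto (fun x => ‖f x‖ * ‖(p x : ℂ) * g' x‖) atTop (nhds 0) := by
  obtain ⟨c, hc, C, hC, h⟩ := sol_decay hPQ z hz hlf
  obtain ⟨A, B, h'⟩ := sol_u_linear hPQ z hz hg hlg
  have l0 : Tendsto (fun x : ℝ => Real.exp (-c * x)) atTop (nhds 0) := by
    have := tendsto_rpow_mul_exp_neg_mul_atTop_nhds_zero 0 c hc
    simpa using this
  have l1 : Tendsto (fun x : ℝ => x * Real.exp (-c * x)) atTop (nhds 0) := by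
    have := tendsto_rpow_mul_exp_neg_mul_atTop_nhds_zero 1 c hc
    simpa using this
  have l2 : Tendsto (fun x : ℝ => C * A * Real.exp (-c * x) + C * B * (x * Real.exp (-c * x)))
      atTop (nhds 0) := by
    simpa using (l0.const_mul (C * A)).add (l1.const_mul (C * B))
  refine squeeze_zero' (Eventually.of_forall fun x => by positivity) ?_ l2
  filter_upwards [h, h'] with x h1 h2
  calc _ ≤ (C * Real.exp (-c * x)) * (A + B * x) :=
        mul_le_mul h1 h2 (norm_nonneg _) (by positivity)
    _ = _ := by ring

lemma sol_ne_zero (hPQ : PQData p p' q q' p₀ x₀) (z : ℂ) (hz : z.im ≠ 0) {f f' : ℝ → ℂ}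
    (hf : IsSol p q z (Ici 0) f f')
    (hl : Tendsto (fun x => f x / aa p q z x) atTop (nhds 1)) (x : ℝ) (hx : 0 ≤ x) :
    f x ≠ 0 := by
  intro h0
  have hfc : ContinuousOn f (Ici 0) := fun x hx => (hf.1 x hx).continuousWithinAt
  have hii : ∀ {a b : ℝ}, 0 ≤ a → 0 ≤ b →
      IntervalIntegrable (fun t => ‖f t‖ ^ 2) volume a b := fun ha hb =>
    ((hfc.norm.pow 2).mono (uIcc_sub ha hb)).intervalIntegrable
  set N : ℝ → ℝ := fun y => ((starRingEnd ℂ) (f y) * (p y * f' y)).im with hN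
  have hNlim : Tendsto N atTop (nhds 0) := by
    refine squeeze_zero_norm (fun y => ?_) (prod_tendsto hPQ z hz hl hf hl)
    refine (Complex.abs_im_le_norm _).trans ?_
    rw [norm_mul, RCLike.norm_conj]
  have hNx : N x = 0 := by simp [hN, h0]
  have hgr : ∀ y, x ≤ y → N y = -z.im * ∫ t in x..y, ‖f t‖ ^ 2 := by
    intro y hy
    have := green hPQ hf hx hy
    simp only [hN] at hNx ⊢
    rw [← this, hNx, sub_zero]
  obtain ⟨Y, hY⟩ := eventually_atTop.1
    ((hl.eventually_ne one_ne_zero).and (eventually_ge_atTop x))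
  have hxY := (hY Y le_rfl).2
  have hpos : 0 < ∫ t in Y..(Y+1), ‖f t‖ ^ 2 := by
    apply intervalIntegral.intervalIntegral_pos_of_pos_on
      (hii (hx.trans hxY) (by linarith)) _ (by linarith)
    intro t ht
    have : f t ≠ 0 := fun h => (hY t ht.1.le).1 (by simp [h])
    positivity
  set d := ∫ t in Y..(Y+1), ‖f t‖ ^ 2 with hd
  have hlow : ∀ᶠ y in atTop, |z.im| * d ≤ |N y| := by
    filter_upwards [eventually_ge_atTop (Y+1)] with y hy
    rw [hgr y (by linarith), abs_mul, abs_neg]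
    apply mul_le_mul_of_nonneg_left _ (abs_nonneg _)
    refine le_trans ?_ (le_abs_self _)
    exact intervalIntegral.integral_mono_interval hxY (by linarith) hy
      (Eventually.of_forall fun t => by positivity) (hii hx (by linarith))
  have h1 := ge_of_tendsto hNlim.abs hlow
  rw [abs_zero] at h1
  have := mul_pos (abs_pos.2 hz) hpos
  linarith

end

/-- for `Im z ≠ 0`, two solutions of the Schrödinger equation on `[0,∞)`
with `θⱼ(x)/a(x,z) → 1` as `x → ∞` coincide on `[0,∞)`. -/
theorem statement9 (p p' q q' : ℝ → ℝ) (p₀ x₀ : ℝ)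
    (hPQ : PQData p p' q q' p₀ x₀)
    (z : ℂ) (hz : z.im ≠ 0)
    (θ₁ θ₁' θ₂ θ₂' : ℝ → ℂ)
    (h₁ : IsSol p q z (Ici 0) θ₁ θ₁')
    (h₂ : IsSol p q z (Ici 0) θ₂ θ₂')
    (hl₁ : Tendsto (fun x => θ₁ x / aa p q z x) atTop (nhds 1))
    (hl₂ : Tendsto (fun x => θ₂ x / aa p q z x) atTop (nhds 1)) :
    ∀ x : ℝ, 0 ≤ x → θ₁ x = θ₂ x := by
  have hW : ∀ x : ℝ, 0 ≤ x → θ₁ x * (p x * θ₂' x) - θ₂ x * (p x * θ₁' x) = 0 := by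
    intro x hx
    have l1 := prod_tendsto hPQ z hz hl₁ h₂ hl₂
    have l2 := prod_tendsto hPQ z hz hl₂ h₁ hl₁
    have l3 : Tendsto (fun y => θ₁ y * (p y * θ₂' y) - θ₂ y * (p y * θ₁' y)) atTop (nhds 0) := by
      refine squeeze_zero_norm (fun y => ?_) ((l1.add l2).trans (by simp))
      refine (norm_sub_le _ _).trans ?_
      rw [norm_mul, norm_mul (θ₂ y)]
    refine tendsto_nhds_unique (Tendsto.congr' ?_ tendsto_const_nhds) l3
    filter_upwards [eventually_ge_atTop x] with y hy
    exact (wronski hPQ h₁ h₂ hx hy).symm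
  have hne := sol_ne_zero hPQ z hz h₁ hl₁
  have hd : ∀ x ∈ Ici (0:ℝ), HasDerivWithinAt (fun t => θ₂ t / θ₁ t) 0 (Ici 0) x := by
    intro x hx
    have h := (h₂.1 x hx).fun_div (h₁.1 x hx) (hne x hx)
    have hp : (p x : ℂ) ≠ 0 := Complex.ofReal_ne_zero.2 (hPQ.p_pos x hx).ne'
    have h3 : (p x : ℂ) * (θ₂' x * θ₁ x - θ₂ x * θ₁' x) = 0 := by
      linear_combination hW x hx
    rw [(mul_eq_zero.1 h3).resolve_left hp, zero_div] at h
    exact h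
  have hconst : ∀ x : ℝ, 0 ≤ x → ∀ y : ℝ, x ≤ y → θ₂ y / θ₁ y = θ₂ x / θ₁ x := by
    intro x hx y hxy
    have := constant_of_has_deriv_right_zero (f := fun t => θ₂ t / θ₁ t) (a := x) (b := y)
      (fun t ht => (hd t (hx.trans ht.1)).continuousWithinAt.mono fun s hs => hx.trans hs.1)
      (fun t ht => (hd t (hx.trans ht.1)).mono fun s hs => (hx.trans ht.1).trans hs)
    exact this y ⟨hxy, le_rfl⟩
  intro x hx
  have l : Tendsto (fun y => θ₂ y / θ₁ y) atTop (nhds 1) := by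
    have := hl₂.div hl₁ one_ne_zero
    rw [div_one] at this
    refine this.congr fun y => ?_
    have ha : aa p q z y ≠ 0 := Complex.exp_ne_zero _
    exact div_div_div_cancel_right₀ ha _ _
  have e : θ₂ x / θ₁ x = 1 := by
    refine tendsto_nhds_unique (Tendsto.congr' ?_ tendsto_const_nhds) l
    filter_upwards [eventually_ge_atTop x] with y hy
    exact (hconst x hx y hy).symm
  exact ((div_eq_one_iff_eq (hne x hx)).1 e).symm

end
end

section
/- There exists a function θ : [0,∞) × {z ∈ ℂ : Im z > 0} → ℂ such that: (i) for every z with Im z > 0, the function θ(·,z) solves the Schrödinger equation with spectral parameter z on [0,∞) and θ(x,z)/a(x,z) → 1 as x → ∞; and (ii) for every x ≥ 0, the map z ↦ θ(x,z) is holomorphic on the open upper half-plane {z : Im z > 0}. -/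
open MeasureTheory Filter Set Complex

noncomputable section

set_option linter.unusedSectionVars false
set_option linter.unusedVariables false

/-- `F` is a locally absolutely continuous primitive of `f`. -/
structure Prim {E : Type*} [NormedAddCommGroup E] [NormedSpace ℝ E] (F f : ℝ → E) : Prop where
  li : LocallyIntegrable f volume
  ftc : ∀ a b : ℝ, F b - F a = ∫ x in a..b, f x

theorem ac_of_dist_le {X Y : Type*} [PseudoMetricSpace X] [PseudoMetricSpace Y]
    {F : ℝ → X} {G : ℝ → Y} {a b C : ℝ}
    (hF : AbsolutelyContinuousOnInterval F a b)
    (h : ∀ x ∈ uIcc a b, ∀ y ∈ uIcc a b, dist (G x) (G y) ≤ C * dist (F x) (F y)) :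
    AbsolutelyContinuousOnInterval G a b := by
  have h2 : Tendsto (fun E : ℕ × (ℕ → ℝ × ℝ) =>
      C * ∑ i ∈ Finset.range E.1, dist (F (E.2 i).1) (F (E.2 i).2))
      (AbsolutelyContinuousOnInterval.totalLengthFilter ⊓
        𝓟 (AbsolutelyContinuousOnInterval.disjWithin a b)) (nhds 0) := by
    have := Tendsto.const_mul C hF
    simpa using this
  refine squeeze_zero' (Eventually.of_forall fun E => Finset.sum_nonneg fun _ _ => dist_nonneg)
    ?_ h2
  have : ∀ᶠ E in (AbsolutelyContinuousOnInterval.totalLengthFilter ⊓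
        𝓟 (AbsolutelyContinuousOnInterval.disjWithin a b)),
        E ∈ AbsolutelyContinuousOnInterval.disjWithin a b :=
    mem_inf_of_right (mem_principal_self _)
  filter_upwards [this] with E hE
  rw [Finset.mul_sum]
  refine Finset.sum_le_sum fun i hi => ?_
  have := hE.1 i hi
  exact h _ this.1 _ this.2

namespace Prim
variable {E : Type*} [NormedAddCommGroup E] [NormedSpace ℝ E] [CompleteSpace E]

theorem ii' {f : ℝ → E} (h : LocallyIntegrable f volume) (a b : ℝ) :
    IntervalIntegrable f volume a b :=
  intervalIntegrable_iff.mpr <|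
      (h.integrableOn_isCompact isCompact_uIcc).mono_set uIoc_subset_uIcc

theorem li_of_ii {f : ℝ → E} (h : ∀ a b, IntervalIntegrable f volume a b) :
    LocallyIntegrable f volume := by
  intro x
  refine ⟨Ioc (x-1) (x+1), Ioc_mem_nhds (by linarith) (by linarith), ?_⟩
  have := h (x-1) (x+1)
  rw [intervalIntegrable_iff, uIoc_of_le (by linarith)] at this
  exact this

theorem ii {F f : ℝ → E} (h : Prim F f) (a b : ℝ) : IntervalIntegrable f volume a b := ii' h.li a b

theorem ac {F f : ℝ → E} (h : Prim F f) (a b : ℝ) : AbsolutelyContinuousOnInterval F a b := by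
  have h1 : IntervalIntegrable (fun x => ‖f x‖) volume a b := (h.ii a b).norm
  have h2 := h1.absolutelyContinuousOnInterval_intervalIntegral (c := a) (by simp)
  refine ac_of_dist_le (C := 1) h2 fun x hx y hy => ?_
  have hn : ∀ u v, IntervalIntegrable (fun x => ‖f x‖) volume u v := fun u v => (h.ii u v).norm
  rw [dist_comm, dist_eq_norm, h.ftc x y, one_mul, dist_comm, dist_eq_norm,
    intervalIntegral.integral_interval_sub_left (hn _ _) (hn _ _)]
  have := intervalIntegral.norm_integral_le_abs_integral_norm (f := f) (a := x) (b := y)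
    (μ := volume)
  simpa using this

theorem continuous {F f : ℝ → E} (h : Prim F f) : Continuous F := by
  have : F = fun x => F 0 + ∫ t in (0:ℝ)..x, f t := by
    ext x; rw [← h.ftc 0 x]; abel
  rw [this]
  exact continuous_const.add (intervalIntegral.continuous_primitive (fun a b => h.ii a b) 0)

theorem ae {F f : ℝ → E} (h : Prim F f) : ∀ᵐ x, HasDerivAt F (f x) x := by
  filter_upwards [LocallyIntegrable.ae_hasDerivAt_integral h.li] with x hx
  have : F = fun x => F 0 + ∫ t in (0:ℝ)..x, f t := by
    ext x; rw [← h.ftc 0 x]; abel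
  rw [this]
  exact (hx 0).const_add _

theorem mk' {F f : ℝ → E} (hf : LocallyIntegrable f volume)
    (hac : ∀ a b, AbsolutelyContinuousOnInterval F a b)
    (hae : ∀ᵐ x, HasDerivAt F (f x) x) : Prim F f := by
  refine ⟨hf, fun a b => ?_⟩
  have hG : Prim (fun x => ∫ t in a..x, f t) f := by
    refine ⟨hf, fun u v => ?_⟩
    exact intervalIntegral.integral_interval_sub_left (ii' hf _ _) (ii' hf _ _)
  have h1 : AbsolutelyContinuousOnInterval (fun x => F x - ∫ t in a..x, f t) a b :=
    (hac a b).fun_sub (hG.ac a b)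
  obtain ⟨C, hC⟩ := h1.const_of_ae_hasDerivAt_zero (by
    filter_upwards [hae, hG.ae] with x h2 h3 _
    have h4 := h2.fun_sub h3
    rwa [sub_self] at h4)
  have e1 := hC a (by simp)
  have e2 := hC b (by simp)
  simp only [intervalIntegral.integral_same, sub_zero] at e1
  rw [e1, ← e2]; abel

theorem of_integral {f : ℝ → E} (hf : LocallyIntegrable f volume) (a : ℝ) :
    Prim (fun x => ∫ t in a..x, f t) f :=
  ⟨hf, fun u v => intervalIntegral.integral_interval_sub_left (ii' hf _ _) (ii' hf _ _)⟩

theorem of_deriv {F f : ℝ → E} (hf : Continuous f) (h : ∀ x, HasDerivAt F (f x) x) : Prim F f :=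
  ⟨hf.locallyIntegrable, fun a b =>
    (intervalIntegral.integral_eq_sub_of_hasDerivAt (fun x _ => h x)
      (hf.intervalIntegrable a b)).symm⟩

theorem hasDerivAt {F f : ℝ → E} (h : Prim F f) (hf : Continuous f) (x : ℝ) :
    HasDerivAt F (f x) x := by
  have : F = fun x => F 0 + ∫ t in (0:ℝ)..x, f t := by
    ext x; rw [← h.ftc 0 x]; abel
  rw [this]
  exact (intervalIntegral.integral_hasDerivAt_right (hf.intervalIntegrable _ _)
    (hf.stronglyMeasurableAtFilter _ _) hf.continuousAt).const_add _

theorem congr_ae {F f g : ℝ → E} (h : Prim F f) (hfg : f =ᵐ[volume] g) : Prim F g := by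
  refine ⟨h.li.congr hfg, fun a b => ?_⟩
  rw [h.ftc a b]
  exact intervalIntegral.integral_congr_ae (hfg.mono fun x hx _ => hx)

theorem congr' {F f g : ℝ → E} (h : Prim F f) (hfg : ∀ x, f x = g x) : Prim F g := by
  have : f = g := funext hfg
  exact this ▸ h

theorem add {F f G g : ℝ → E} (h : Prim F f) (h' : Prim G g) :
    Prim (fun x => F x + G x) (fun x => f x + g x) := by
  refine ⟨h.li.add h'.li, fun a b => ?_⟩
  rw [intervalIntegral.integral_add (h.ii a b) (h'.ii a b), ← h.ftc, ← h'.ftc]; abel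

theorem neg {F f : ℝ → E} (h : Prim F f) : Prim (fun x => - F x) (fun x => - f x) := by
  refine ⟨h.li.neg, fun a b => ?_⟩
  rw [intervalIntegral.integral_neg, ← h.ftc]; abel

theorem sub {F f G g : ℝ → E} (h : Prim F f) (h' : Prim G g) :
    Prim (fun x => F x - G x) (fun x => f x - g x) := by
  simpa [sub_eq_add_neg] using h.add h'.neg

theorem const (c : E) : Prim (fun _ : ℝ => c) (fun _ => 0) :=
  ⟨continuous_const.locallyIntegrable, by simp⟩

variable {𝕜 : Type*} [RCLike 𝕜]

theorem mul {F f G g : ℝ → 𝕜} (h : Prim F f) (h' : Prim G g) :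
    Prim (fun x => F x * G x) (fun x => f x * G x + F x * g x) := by
  refine mk' (li_of_ii fun a b => ?_) (fun a b => ?_) ?_
  · exact ((h.ii a b).mul_continuousOn h'.continuous.continuousOn).add
      ((h'.ii a b).continuousOn_mul h.continuous.continuousOn)
  · exact (h.ac a b).fun_smul (h'.ac a b)
  · filter_upwards [h.ae, h'.ae] with x h1 h2
    exact h1.mul h2

theorem pow {F f : ℝ → 𝕜} (h : Prim F f) (n : ℕ) :
    Prim (fun x => F x ^ (n+1)) (fun x => (n+1) * F x ^ n * f x) := by
  induction n with
  | zero => simpa using h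
  | succ n ih =>
    have := ih.mul h
    simp only [← pow_succ] at this
    refine (this.congr' (g := fun x => ((n+1 : ℕ)+1) * F x ^ (n+1) * f x) fun x => ?_)
    push_cast; ring

theorem ofReal {F f : ℝ → ℝ} (h : Prim F f) : Prim (fun x => (F x : ℂ)) (fun x => (f x : ℂ)) := by
  refine ⟨li_of_ii fun a b => intervalIntegrable_iff.mpr
    (intervalIntegrable_iff.mp (h.ii a b)).ofReal, fun a b => ?_⟩
  rw [intervalIntegral.integral_ofReal, ← h.ftc]; push_cast; rfl

/-- Chain rule for a square root. -/
theorem sqrt {S S' s : ℝ → ℂ} (h : Prim S S') (hs : Continuous s) (hsq : ∀ x, s x ^ 2 = S x)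
    (hpos : ∀ x, 0 < (s x).re) : Prim s (fun x => S' x / (2 * s x)) := by
  have hne : ∀ x, s x ≠ 0 := fun x h0 => by have := hpos x; simp [h0] at this
  refine mk' (li_of_ii fun a b => ?_) (fun a b => ?_) ?_
  · simp only [div_eq_mul_inv]
    refine (h.ii a b).mul_continuousOn (Continuous.continuousOn ?_)
    exact (continuous_const.mul hs).inv₀ fun x => mul_ne_zero two_ne_zero (hne x)
  · obtain ⟨x0, _, hx0⟩ := isCompact_uIcc.exists_isMinOn (nonempty_uIcc (a := a) (b := b))
      (continuous_re.comp hs).continuousOn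
    refine ac_of_dist_le (C := ((s x0).re)⁻¹) (h.ac a b) fun x hx y hy => ?_
    rw [dist_eq_norm, dist_eq_norm, ← hsq, ← hsq, sq_sub_sq, norm_mul, ← div_eq_inv_mul,
      le_div_iff₀ (hpos x0), mul_comm]
    refine mul_le_mul_of_nonneg_right ?_ (norm_nonneg _)
    have h1 := (abs_le.mp (abs_re_le_norm (s x + s y))).2
    have h2 := hpos y
    have h3 : (s x0).re ≤ (s x).re := hx0 hx
    simp only [add_re] at h1
    linarith
  · filter_upwards [h.ae] with x hx
    rw [hasDerivAt_iff_tendsto_slope] at hx ⊢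
    have h1 : Tendsto (fun y => (s y + s x)⁻¹) (nhdsWithin x {x}ᶜ) (nhds ((s x + s x)⁻¹)) :=
      (((hs.add continuous_const).continuousAt (x := x)).inv₀
        (by change s x + s x ≠ 0; rw [← two_mul]; exact mul_ne_zero two_ne_zero (hne x))).mono_left nhdsWithin_le_nhds
    have h2 := hx.mul h1
    rw [← two_mul, ← div_eq_mul_inv] at h2
    refine h2.congr fun y => ?_
    have h3 : s y + s x ≠ 0 := by
      intro h0
      have h4 : (s y + s x).re = 0 := by rw [h0]; simp
      have := hpos x; have := hpos y
      simp only [add_re] at h4; linarith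
    simp only [slope, vsub_eq_sub, ← hsq, sq_sub_sq, smul_mul_assoc]
    congr 1
    field_simp
end Prim


theorem holo_integral {μ : Measure ℝ} {F : ℂ → ℝ → ℂ} {U : Set ℂ} (hU : IsOpen U)
    {bound : ℝ → ℝ} (hb : Integrable bound μ)
    (hmeas : ∀ z ∈ U, AEStronglyMeasurable (F z) μ)
    (hbd : ∀ᵐ y ∂μ, ∀ z ∈ U, ‖F z y‖ ≤ bound y)
    (hd : ∀ᵐ y ∂μ, DifferentiableOn ℂ (fun z => F z y) U) :
    DifferentiableOn ℂ (fun z => ∫ y, F z y ∂μ) U := by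
  intro z0 hz0
  obtain ⟨R, hR, hRU⟩ := Metric.isOpen_iff.mp hU z0 hz0
  have hR2 : 0 < R / 2 := by linarith
  have hball : ∀ w ∈ Metric.ball z0 (R/2), Metric.ball w (R/2) ⊆ U := by
    intro w hw v hv
    apply hRU
    rw [Metric.mem_ball] at *
    linarith [dist_triangle v w z0]
  have key := hasDerivAt_integral_of_dominated_loc_of_deriv_le (μ := μ) (F := F) (x₀ := z0)
    (s := Metric.ball z0 (R/2)) (F' := fun z y => deriv (fun z => F z y) z)
    (bound := fun y => bound y / (R/4)) (Metric.ball_mem_nhds _ hR2)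
    (by filter_upwards [hU.mem_nhds hz0] with z hz using hmeas z hz)
    (hb.mono' (hmeas z0 hz0) (hbd.mono fun y hy => hy z0 hz0))
    ?_ ?_ (hb.div_const _) ?_
  · exact key.2.differentiableAt.differentiableWithinAt
  ·
    have hseq : Tendsto (fun n : ℕ => z0 + ((R / 2 / (n + 1) : ℝ) : ℂ)) atTop
        (nhdsWithin z0 {z0}ᶜ) := by
      rw [tendsto_nhdsWithin_iff]
      constructor
      · have h0 : Tendsto (fun n : ℕ => (R / 2 / (n + 1) : ℝ)) atTop (nhds 0) := by
          have := (tendsto_one_div_add_atTop_nhds_zero_nat (𝕜 := ℝ)).const_mul (R/2)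
          simpa [div_eq_mul_inv] using this
        have h1 := (continuous_ofReal.tendsto 0).comp h0
        have := h1.const_add z0
        simpa using this
      · refine Eventually.of_forall fun n => ?_
        simp only [mem_compl_iff, mem_singleton_iff, add_eq_left, ofReal_eq_zero]
        positivity
    refine aestronglyMeasurable_of_tendsto_ae atTop
      (f := fun (n : ℕ) y => slope (fun z => F z y) z0 (z0 + ((R / 2 / (n + 1) : ℝ) : ℂ))) ?_ ?_
    · intro n
      simp only [slope, vsub_eq_sub]
      suffices h : AEStronglyMeasurable
          (fun y => F (z0 + ((R / 2 / (n + 1) : ℝ) : ℂ)) y - F z0 y) μ from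
          h.const_smul ((z0 + ((R / 2 / (n + 1) : ℝ) : ℂ)) - z0)⁻¹
      refine (hmeas _ ?_).sub (hmeas _ hz0)
      apply hRU
      rw [Metric.mem_ball, dist_eq_norm, add_sub_cancel_left, norm_real, Real.norm_of_nonneg (by positivity)]
      have : R / 2 / ((n:ℝ) + 1) ≤ R / 2 := div_le_self hR2.le (by linarith [n.cast_nonneg (α := ℝ)])
      linarith
    · filter_upwards [hd] with y hy
      have := ((hy z0 hz0).differentiableAt (hU.mem_nhds hz0)).hasDerivAt
      rw [hasDerivAt_iff_tendsto_slope] at this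
      exact this.comp hseq
  · filter_upwards [hbd, hd] with y h1 h2 w hw
    have hsub : Metric.closedBall w (R/4) ⊆ U :=
      (Metric.closedBall_subset_ball (by linarith)).trans (hball w hw)
    refine norm_deriv_le_of_forall_mem_sphere_norm_le (by linarith) ?_ ?_
    · exact (h2.mono hsub).diffContOnCl_ball (Subset.refl _)
    · intro v hv
      exact h1 v (hsub (Metric.sphere_subset_closedBall hv))
  · filter_upwards [hd] with y h2 w hw
    have hwU : w ∈ U := hball w hw (Metric.mem_ball_self hR2)
    exact ((h2 w hwU).differentiableAt (hU.mem_nhds hwU)).hasDerivAt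

section tail
variable {E : Type*} [NormedAddCommGroup E] [NormedSpace ℝ E] [CompleteSpace E]

theorem prim_tail {f : ℝ → E} (hf : ∀ a, IntegrableOn f (Ioi a)) :
    Prim (fun x => ∫ y in Ioi x, f y) (fun y => - f y) := by
  have hii : ∀ a b, IntervalIntegrable f volume a b := by
    intro a b
    rw [intervalIntegrable_iff]
    exact (hf (min a b)).mono_set (fun x hx => hx.1)
  refine ⟨(Prim.li_of_ii hii).neg, fun a b => ?_⟩
  rw [intervalIntegral.integral_neg, ← intervalIntegral.integral_interval_add_Ioi (hf a) (hf b)]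
  abel

theorem tail_tendsto {f : ℝ → E} (hf : ∀ a, IntegrableOn f (Ioi a)) :
    Tendsto (fun x => ∫ y in Ioi x, f y) atTop (nhds 0) := by
  have h1 := intervalIntegral_tendsto_integral_Ioi 0 (hf 0) tendsto_id
  have h2 := h1.const_sub (∫ y in Ioi (0:ℝ), f y)
  rw [sub_self] at h2
  refine h2.congr fun x => ?_
  rw [← intervalIntegral.integral_interval_add_Ioi (hf 0) (hf x)]
  simp
end tail

/-- `∫ₓ^∞ f Eⁿ/n! = E(x)^{n+1}/(n+1)!` with `E(x) = ∫ₓ^∞ f`. -/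
theorem tail_pow {f : ℝ → ℝ} (hf : Integrable f) (h0 : ∀ x, 0 ≤ f x) (n : ℕ) :
    Integrable (fun y => f y * ((∫ t in Ioi y, f t) ^ n / n.factorial)) ∧
    ∀ x, ∫ y in Ioi x, f y * ((∫ t in Ioi y, f t) ^ n / n.factorial) =
      (∫ t in Ioi x, f t) ^ (n+1) / (n+1).factorial := by
  have hE := prim_tail (f := f) (fun a => hf.integrableOn)
  have hInt0 : Integrable (fun y => f y * ((∫ t in Ioi y, f t) ^ n / n.factorial)) := by
    refine hf.mul_bdd (c := (∫ t, f t) ^ n / n.factorial)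
      ((hE.continuous.pow n).div_const _).aestronglyMeasurable ?_
    refine Eventually.of_forall fun y => ?_
    have h1 : 0 ≤ ∫ t in Ioi y, f t := integral_nonneg h0
    have h2 : ∫ t in Ioi y, f t ≤ ∫ t, f t := setIntegral_le_integral hf (Eventually.of_forall h0)
    rw [Real.norm_of_nonneg (by positivity)]
    gcongr
  refine ⟨hInt0, fun x => ?_⟩
  have h1 := intervalIntegral_tendsto_integral_Ioi x hInt0.integrableOn tendsto_id
  have hP := hE.pow n
  have h2 : Tendsto (fun b => ((∫ t in Ioi x, f t) ^ (n+1) - (∫ t in Ioi b, f t) ^ (n+1))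
      / (n+1).factorial) atTop
      (nhds (((∫ t in Ioi x, f t) ^ (n+1) - 0 ^ (n+1)) / (n+1).factorial)) :=
    (((tail_tendsto (f := f) (fun a => hf.integrableOn)).pow (n+1)).const_sub _).div_const _
  rw [zero_pow (Nat.succ_ne_zero n), sub_zero] at h2
  refine tendsto_nhds_unique h1 (h2.congr fun b => ?_)
  rw [← neg_sub, hP.ftc x b, id, neg_div, ← intervalIntegral.integral_div,
    ← intervalIntegral.integral_neg]
  congr 1
  ext y
  rw [Nat.factorial_succ]
  have : (n.factorial : ℝ) ≠ 0 := by positivity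
  push_cast
  field_simp


/-- Terms of the Neumann series for the diagonalised Volterra system. -/
def uvT (α β Om : ℂ → ℝ → ℂ) : ℕ → ℂ → ℝ → ℂ × ℂ
  | 0 => fun _ _ => (1, 0)
  | n + 1 => fun z x =>
    (∫ y in Ioi x, (α z y * (uvT α β Om n z y).1 + β z y * (uvT α β Om n z y).2),
     -∫ y in Ioi x, cexp (-2 * (Om z y - Om z x)) *
        (α z y * (uvT α β Om n z y).1 + β z y * (uvT α β Om n z y).2))

/-- The source term `w_n`. -/
def wT (α β Om : ℂ → ℝ → ℂ) (n : ℕ) (z : ℂ) (y : ℝ) : ℂ :=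
  α z y * (uvT α β Om n z y).1 + β z y * (uvT α β Om n z y).2

/-- Hypotheses at a fixed spectral parameter. -/
structure VHyp (α β Om : ℂ → ℝ → ℂ) (m : ℝ → ℝ) (z : ℂ) : Prop where
  mi : Integrable m
  α_meas : AEStronglyMeasurable (α z) volume
  β_meas : AEStronglyMeasurable (β z) volume
  α_le : ∀ y, ‖α z y‖ ≤ m y
  β_le : ∀ y, ‖β z y‖ ≤ m y
  Om_cont : Continuous (Om z)
  Om_mono : ∀ x y, x ≤ y → (Om z x).re ≤ (Om z y).re

section
variable {α β Om : ℂ → ℝ → ℂ} {m : ℝ → ℝ} {z : ℂ}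

theorem VHyp.m0 (h : VHyp α β Om m z) (y : ℝ) : 0 ≤ m y := (norm_nonneg _).trans (h.α_le y)

theorem exp_le_one (h : VHyp α β Om m z) {x y : ℝ} (hxy : x ≤ y) :
    ‖cexp (-2 * (Om z y - Om z x))‖ ≤ 1 := by
  rw [norm_exp, Real.exp_le_one_iff]
  have := h.Om_mono x y hxy
  simp
  linarith

/-- The majorant. -/
def EE (m : ℝ → ℝ) (x : ℝ) : ℝ := ∫ t in Ioi x, 2 * m t

theorem kernel_int (h : VHyp α β Om m z) {w : ℝ → ℂ} (hw : Integrable w) (x a : ℝ) :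
    IntegrableOn (fun y => cexp (-2 * (Om z y - Om z x)) * w y) (Ioi a) := by
  have hc : Continuous (fun y => cexp (-2 * (Om z y - Om z x))) := by
    have := h.Om_cont
    fun_prop
  refine hw.integrableOn.bdd_mul (c := ‖cexp (-2 * (Om z a - Om z x))‖)
    hc.aestronglyMeasurable ?_
  refine (ae_restrict_mem measurableSet_Ioi).mono fun y hy => ?_
  have : -2 * (Om z y - Om z x) = -2 * (Om z y - Om z a) + -2 * (Om z a - Om z x) := by ring
  rw [this, exp_add, norm_mul]
  exact mul_le_of_le_one_left (norm_nonneg _) (exp_le_one h (le_of_lt hy))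

theorem kernel_prim (h : VHyp α β Om m z) {w : ℝ → ℂ} (hw : Integrable w) :
    Prim (fun x => cexp (-2 * Om z x) *
      (-∫ y in Ioi x, cexp (-2 * (Om z y - Om z x)) * w y))
      (fun x => cexp (-2 * Om z x) * w x) := by
  have h1 := (prim_tail (f := fun y => cexp (-2 * Om z y) * w y) (fun a => by
    have := (kernel_int h hw 0 a).const_mul (cexp (-2 * Om z 0))
    refine this.congr (Eventually.of_forall fun y => ?_)
    simp only
    rw [← mul_assoc, ← exp_add]; congr 2; ring)).neg
  simp only [neg_neg] at h1
  convert h1 using 2 with x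
  rw [mul_neg, ← integral_const_mul]
  congr 2
  ext y
  rw [← mul_assoc, ← exp_add]; congr 2; ring

theorem kernel_cont (h : VHyp α β Om m z) {w : ℝ → ℂ} (hw : Integrable w) :
    Continuous (fun x => -∫ y in Ioi x, cexp (-2 * (Om z y - Om z x)) * w y) := by
  have h1 := (kernel_prim h hw).continuous
  have h2 : Continuous (fun x => cexp (2 * Om z x)) := by
    have := h.Om_cont
    fun_prop
  refine (h2.mul h1).congr fun x => ?_
  simp only [Pi.mul_apply]
  rw [← mul_assoc, ← exp_add]
  simp

theorem kernel_le (h : VHyp α β Om m z) {w : ℝ → ℂ} (hw : Integrable w) (x : ℝ) :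
    ‖-∫ y in Ioi x, cexp (-2 * (Om z y - Om z x)) * w y‖ ≤ ∫ y in Ioi x, ‖w y‖ := by
  rw [norm_neg]
  refine (norm_integral_le_integral_norm _).trans ?_
  refine setIntegral_mono_on (kernel_int h hw x x).norm hw.norm.integrableOn measurableSet_Ioi
    fun y hy => ?_
  rw [norm_mul]
  exact mul_le_of_le_one_left (norm_nonneg _) (exp_le_one h (le_of_lt hy))

theorem EE_nonneg (h : VHyp α β Om m z) (x : ℝ) : 0 ≤ EE m x :=
  integral_nonneg fun y => by have := h.m0 y; positivity

theorem EE_anti (h : VHyp α β Om m z) (x : ℝ) : EE m x ≤ ∫ t, 2 * m t :=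
  setIntegral_le_integral (h.mi.const_mul 2)
    (Eventually.of_forall fun y => by have := h.m0 y; simp only [Pi.zero_apply]; positivity)

theorem uvT_props (h : VHyp α β Om m z) (n : ℕ) :
    (Continuous (fun x => (uvT α β Om n z x).1) ∧ Continuous (fun x => (uvT α β Om n z x).2)) ∧
    (∀ x, ‖(uvT α β Om n z x).1‖ ≤ EE m x ^ n / n.factorial) ∧
    (∀ x, ‖(uvT α β Om n z x).2‖ ≤ EE m x ^ n / n.factorial) ∧
    Integrable (wT α β Om n z) ∧
    (∀ y, ‖wT α β Om n z y‖ ≤ 2 * m y * (EE m y ^ n / n.factorial)) := by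
  have hw : ∀ n, (Continuous (fun x => (uvT α β Om n z x).1) ∧
      Continuous (fun x => (uvT α β Om n z x).2)) →
    (∀ x, ‖(uvT α β Om n z x).1‖ ≤ EE m x ^ n / n.factorial) →
    (∀ x, ‖(uvT α β Om n z x).2‖ ≤ EE m x ^ n / n.factorial) →
    Integrable (wT α β Om n z) ∧
    (∀ y, ‖wT α β Om n z y‖ ≤ 2 * m y * (EE m y ^ n / n.factorial)) := by
    intro n hc hu hv
    have hb : ∀ y, ‖wT α β Om n z y‖ ≤ 2 * m y * (EE m y ^ n / n.factorial) := by
      intro y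
      refine (norm_add_le _ _).trans ?_
      rw [norm_mul, norm_mul]
      have h1 := mul_le_mul (h.α_le y) (hu y) (norm_nonneg _) (h.m0 y)
      have h2 := mul_le_mul (h.β_le y) (hv y) (norm_nonneg _) (h.m0 y)
      linarith
    refine ⟨?_, hb⟩
    refine (tail_pow (h.mi.const_mul 2) (fun y => by have := h.m0 y; positivity) n).1.mono' ?_
      (Eventually.of_forall hb)
    exact (h.α_meas.mul hc.1.aestronglyMeasurable).add (h.β_meas.mul hc.2.aestronglyMeasurable)
  induction n with
  | zero =>
    have hc : (Continuous (fun x => (uvT α β Om 0 z x).1) ∧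
      Continuous (fun x => (uvT α β Om 0 z x).2)) := by
      simp only [uvT]; exact ⟨continuous_const, continuous_const⟩
    have hu : ∀ x, ‖(uvT α β Om 0 z x).1‖ ≤ EE m x ^ 0 / (0).factorial := by simp [uvT]
    have hv : ∀ x, ‖(uvT α β Om 0 z x).2‖ ≤ EE m x ^ 0 / (0).factorial := by simp [uvT]
    exact ⟨hc, hu, hv, hw 0 hc hu hv⟩
  | succ n ih =>
    obtain ⟨_, _, _, hi, hb⟩ := ih
    have htp := tail_pow (h.mi.const_mul 2) (fun y => by have := h.m0 y; positivity) n
    have hle : ∀ x, ∫ y in Ioi x, ‖wT α β Om n z y‖ ≤ EE m x ^ (n+1) / (n+1).factorial := by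
      intro x
      have h3 := htp.2 x
      unfold EE
      rw [← h3]
      exact integral_mono hi.norm.integrableOn htp.1.integrableOn hb
    have hc : (Continuous (fun x => (uvT α β Om (n+1) z x).1) ∧
      Continuous (fun x => (uvT α β Om (n+1) z x).2)) := by
      constructor
      · exact (prim_tail (f := wT α β Om n z) fun a => hi.integrableOn).continuous
      · exact kernel_cont h hi
    have hu : ∀ x, ‖(uvT α β Om (n+1) z x).1‖ ≤ EE m x ^ (n+1) / (n+1).factorial :=
      fun x => (norm_integral_le_integral_norm _).trans (hle x)
    have hv : ∀ x, ‖(uvT α β Om (n+1) z x).2‖ ≤ EE m x ^ (n+1) / (n+1).factorial :=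
      fun x => (kernel_le h hi x).trans (hle x)
    exact ⟨hc, hu, hv, hw (n+1) hc hu hv⟩

end

/-- Sum of the Neumann series, first component. -/
def US (α β Om : ℂ → ℝ → ℂ) (z : ℂ) (x : ℝ) : ℂ := ∑' n, (uvT α β Om n z x).1
/-- Sum of the Neumann series, second component. -/
def VS (α β Om : ℂ → ℝ → ℂ) (z : ℂ) (x : ℝ) : ℂ := ∑' n, (uvT α β Om n z x).2
/-- The source. -/
def WS (α β Om : ℂ → ℝ → ℂ) (z : ℂ) (y : ℝ) : ℂ :=
  α z y * US α β Om z y + β z y * VS α β Om z y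

section
variable {α β Om : ℂ → ℝ → ℂ} {m : ℝ → ℝ} {z : ℂ}

theorem sum_u (h : VHyp α β Om m z) (x : ℝ) : Summable (fun n => (uvT α β Om n z x).1) :=
  Summable.of_norm_bounded (Real.summable_pow_div_factorial (EE m x))
    fun n => (uvT_props h n).2.1 x

theorem sum_v (h : VHyp α β Om m z) (x : ℝ) : Summable (fun n => (uvT α β Om n z x).2) :=
  Summable.of_norm_bounded (Real.summable_pow_div_factorial (EE m x))
    fun n => (uvT_props h n).2.2.1 x

theorem hasSum_w (h : VHyp α β Om m z) (x : ℝ) :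
    HasSum (fun n => wT α β Om n z x) (WS α β Om z x) :=
  ((sum_u h x).hasSum.mul_left _).add ((sum_v h x).hasSum.mul_left _)

theorem int_w_le (h : VHyp α β Om m z) (n : ℕ) (x : ℝ) :
    ∫ y in Ioi x, ‖wT α β Om n z y‖ ≤ EE m x ^ (n+1) / (n+1).factorial := by
  have htp := tail_pow (h.mi.const_mul 2) (fun y => by have := h.m0 y; positivity) n
  have h3 := htp.2 x
  unfold EE
  rw [← h3]
  exact integral_mono (uvT_props h n).2.2.2.1.norm.integrableOn htp.1.integrableOn
    (uvT_props h n).2.2.2.2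

theorem WS_int (h : VHyp α β Om m z) : Integrable (WS α β Om z) := by
  have hm : AEStronglyMeasurable (WS α β Om z) volume := by
    refine aestronglyMeasurable_of_tendsto_ae atTop
      (f := fun n y => ∑ i ∈ Finset.range n, wT α β Om i z y) ?_
      (Eventually.of_forall fun y => (hasSum_w h y).tendsto_sum_nat)
    intro n
    exact Finset.aestronglyMeasurable_fun_sum _ fun i _ => (uvT_props h i).2.2.2.1.1
  refine (((h.mi.const_mul 2).mul_const (Real.exp (∫ t, 2 * m t)))).mono' hm
    (Eventually.of_forall fun y => ?_)
  have h1 : HasSum (fun n : ℕ => 2 * m y * ((∫ t, 2 * m t) ^ n / n.factorial))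
      (2 * m y * Real.exp (∫ t, 2 * m t)) := by
    refine HasSum.mul_left _ ?_
    rw [Real.exp_eq_exp_ℝ]
    have := NormedSpace.exp_series_hasSum_exp' (𝕂 := ℝ) (∫ t, 2 * m t)
    simpa only [smul_eq_mul, ← div_eq_inv_mul] using this
  refine (hasSum_w h y).norm_le_of_bounded h1 fun n => ?_
  refine ((uvT_props h n).2.2.2.2 y).trans ?_
  have := h.m0 y
  have := EE_nonneg h y
  have := EE_anti h y
  gcongr

theorem US_eq (h : VHyp α β Om m z) (x : ℝ) :
    US α β Om z x = 1 + ∫ y in Ioi x, WS α β Om z y := by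
  have h1 := hasSum_integral_of_summable_integral_norm (μ := volume.restrict (Ioi x))
    (F := fun n y => wT α β Om n z y) (fun n => (uvT_props h n).2.2.2.1.integrableOn)
    (Summable.of_nonneg_of_le (fun n => integral_nonneg fun _ => norm_nonneg _)
      (fun n => int_w_le h n x)
      ((summable_nat_add_iff 1).mpr (Real.summable_pow_div_factorial (EE m x))))
  have h2 : ∀ y, ∑' n, wT α β Om n z y = WS α β Om z y := fun y => (hasSum_w h y).tsum_eq
  simp only [h2] at h1
  rw [US, (sum_u h x).tsum_eq_zero_add, ← h1.tsum_eq]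
  rfl

theorem VS_eq (h : VHyp α β Om m z) (x : ℝ) :
    VS α β Om z x = -∫ y in Ioi x, cexp (-2 * (Om z y - Om z x)) * WS α β Om z y := by
  have hle : ∀ n, ∫ y in Ioi x, ‖cexp (-2 * (Om z y - Om z x)) * wT α β Om n z y‖ ≤
      ∫ y in Ioi x, ‖wT α β Om n z y‖ := by
    intro n
    refine setIntegral_mono_on (kernel_int h (uvT_props h n).2.2.2.1 x x).norm
      (uvT_props h n).2.2.2.1.norm.integrableOn measurableSet_Ioi fun y hy => ?_
    rw [norm_mul]
    exact mul_le_of_le_one_left (norm_nonneg _) (exp_le_one h (le_of_lt hy))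
  have h1 := hasSum_integral_of_summable_integral_norm (μ := volume.restrict (Ioi x))
    (F := fun n y => cexp (-2 * (Om z y - Om z x)) * wT α β Om n z y)
    (fun n => kernel_int h (uvT_props h n).2.2.2.1 x x)
    (Summable.of_nonneg_of_le (fun n => integral_nonneg fun _ => norm_nonneg _)
      (fun n => (hle n).trans (int_w_le h n x))
      ((summable_nat_add_iff 1).mpr (Real.summable_pow_div_factorial (EE m x))))
  have h2 : ∀ y, ∑' n, cexp (-2 * (Om z y - Om z x)) * wT α β Om n z y =
      cexp (-2 * (Om z y - Om z x)) * WS α β Om z y :=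
    fun y => ((hasSum_w h y).mul_left _).tsum_eq
  simp only [h2] at h1
  rw [VS, (sum_v h x).tsum_eq_zero_add, ← h1.neg.tsum_eq]
  simp only [uvT, zero_add]
  rfl

theorem US_prim (h : VHyp α β Om m z) :
    Prim (US α β Om z) (fun x => - WS α β Om z x) := by
  have h1 := (Prim.const (1:ℂ)).add (prim_tail (f := WS α β Om z) fun a => (WS_int h).integrableOn)
  simp only [zero_add] at h1
  have : US α β Om z = fun x => 1 + ∫ y in Ioi x, WS α β Om z y := funext (US_eq h)
  rw [this]; exact h1

theorem VS_prim (h : VHyp α β Om m z) :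
    Prim (fun x => cexp (-2 * Om z x) * VS α β Om z x)
      (fun x => cexp (-2 * Om z x) * WS α β Om z x) := by
  have h1 := kernel_prim h (WS_int h)
  simp only [← VS_eq h] at h1
  exact h1

theorem US_lim (h : VHyp α β Om m z) : Tendsto (US α β Om z) atTop (nhds 1) := by
  have h1 := (tail_tendsto (f := WS α β Om z) fun a => (WS_int h).integrableOn).const_add 1
  rw [add_zero] at h1
  exact h1.congr fun x => (US_eq h x).symm

theorem VS_lim (h : VHyp α β Om m z) : Tendsto (VS α β Om z) atTop (nhds 0) := by
  have h1 := tail_tendsto (f := fun y => ‖WS α β Om z y‖) fun a => (WS_int h).norm.integrableOn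
  refine squeeze_zero_norm (fun x => ?_) h1
  rw [VS_eq h]
  exact kernel_le h (WS_int h) x
end

section
variable {α β Om : ℂ → ℝ → ℂ} {m : ℝ → ℝ} {U : Set ℂ}

theorem uvT_holo (hU : IsOpen U) (h : ∀ z ∈ U, VHyp α β Om m z)
    (hα : ∀ y, DifferentiableOn ℂ (fun z => α z y) U)
    (hβ : ∀ y, DifferentiableOn ℂ (fun z => β z y) U)
    (hO : ∀ y, DifferentiableOn ℂ (fun z => Om z y) U) (n : ℕ) :
    ∀ x, DifferentiableOn ℂ (fun z => (uvT α β Om n z x).1) U ∧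
      DifferentiableOn ℂ (fun z => (uvT α β Om n z x).2) U := by
  rcases U.eq_empty_or_nonempty with rfl | ⟨z1, hz1⟩
  · intro x; exact ⟨differentiableOn_empty, differentiableOn_empty⟩
  induction n with
  | zero => intro x; simp only [uvT]; exact ⟨differentiableOn_const _, differentiableOn_const _⟩
  | succ n ih =>
    intro x
    have htp := tail_pow ((h z1 hz1).mi.const_mul 2)
      (fun y => by have := (h z1 hz1).m0 y; positivity) n
    have hwd : ∀ y, DifferentiableOn ℂ (fun z => wT α β Om n z y) U := fun y =>
      ((hα y).mul (ih y).1).add ((hβ y).mul (ih y).2)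
    constructor
    · refine holo_integral (μ := volume.restrict (Ioi x)) (F := fun z y => wT α β Om n z y) hU
        htp.1.integrableOn (fun z hz => (uvT_props (h z hz) n).2.2.2.1.1.restrict) ?_ ?_
      · exact Eventually.of_forall fun y z hz => (uvT_props (h z hz) n).2.2.2.2 y
      · exact Eventually.of_forall hwd
    · refine (holo_integral (μ := volume.restrict (Ioi x))
        (F := fun z y => cexp (-2 * (Om z y - Om z x)) * wT α β Om n z y) hU
        htp.1.integrableOn
        (fun z hz => (kernel_int (h z hz) (uvT_props (h z hz) n).2.2.2.1 x x).1) ?_ ?_).neg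
      · refine (ae_restrict_mem measurableSet_Ioi).mono fun y hy z hz => ?_
        rw [norm_mul]
        exact (mul_le_of_le_one_left (norm_nonneg _) (exp_le_one (h z hz) (le_of_lt hy))).trans
          ((uvT_props (h z hz) n).2.2.2.2 y)
      · exact Eventually.of_forall fun y =>
          (((((hO y).sub (hO x)).const_mul (-2))).cexp).mul (hwd y)

theorem UVS_holo (hU : IsOpen U) (h : ∀ z ∈ U, VHyp α β Om m z)
    (hα : ∀ y, DifferentiableOn ℂ (fun z => α z y) U)
    (hβ : ∀ y, DifferentiableOn ℂ (fun z => β z y) U)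
    (hO : ∀ y, DifferentiableOn ℂ (fun z => Om z y) U) (x : ℝ) :
    DifferentiableOn ℂ (fun z => US α β Om z x) U ∧
      DifferentiableOn ℂ (fun z => VS α β Om z x) U :=
  ⟨differentiableOn_tsum_of_summable_norm (Real.summable_pow_div_factorial (EE m x))
    (fun n => (uvT_holo hU h hα hβ hO n x).1) hU
    (fun n z hz => (uvT_props (h z hz) n).2.1 x),
   differentiableOn_tsum_of_summable_norm (Real.summable_pow_div_factorial (EE m x))
    (fun n => (uvT_holo hU h hα hβ hO n x).2) hU
    (fun n z hz => (uvT_props (h z hz) n).2.2.1 x)⟩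
end


theorem half_sq (w : ℂ) : (w ^ (1/2 : ℂ)) ^ 2 = w := by
  rw [one_div]
  exact cpow_ofNat_inv_pow w 2

theorem half_re_pos {w : ℂ} (hw : w ∈ slitPlane) : 0 < (w ^ (1/2 : ℂ)).re := by
  have h0 := slitPlane_ne_zero hw
  rw [cpow_def_of_ne_zero h0, exp_re]
  refine mul_pos (Real.exp_pos _) (Real.cos_pos_of_mem_Ioo ?_)
  have h1 : (log w * (1/2)).im = w.arg / 2 := by
    have : log w * (1/2) = ((1/2 : ℝ) : ℂ) * log w := by push_cast; ring
    rw [this, im_ofReal_mul, log_im]; ring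
  rw [h1]
  have h2 := (mem_slitPlane_iff_arg.mp hw).1
  have h3 := arg_le_pi w
  have h4 := neg_pi_lt_arg w
  have h5 : w.arg < Real.pi := lt_of_le_of_ne h3 h2
  constructor <;> linarith

theorem half_norm_sq (w : ℂ) : ‖w ^ (1/2 : ℂ)‖ ^ 2 = ‖w‖ := by
  rw [← norm_pow, half_sq]

theorem half_norm_le (w : ℂ) : ‖w ^ (1/2 : ℂ)‖ ≤ 1 + ‖w‖ := by
  have := half_norm_sq w
  nlinarith [sq_nonneg (‖w ^ (1/2 : ℂ)‖ - 1), norm_nonneg w]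

theorem eq_of_sq_re {a b : ℂ} (h : a ^ 2 = b ^ 2) (ha : 0 < a.re) (hb : 0 < b.re) : a = b := by
  rcases sq_eq_sq_iff_eq_or_eq_neg.mp h with h | h
  · exact h
  · rw [h] at ha; simp at ha; linarith

theorem slit_of_im {w : ℂ} (h : w.im < 0) : w ∈ slitPlane :=
  mem_slitPlane_iff.mpr (Or.inr h.ne)

/-- the open upper half plane -/
def HH : Set ℂ := {z : ℂ | 0 < z.im}

theorem HH_open : IsOpen HH := isOpen_lt continuous_const continuous_im

theorem holo_interval {F : ℂ → ℝ → ℂ} {a b : ℝ}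
    (hmeas : ∀ z ∈ HH, AEStronglyMeasurable (F z) (volume.restrict (uIoc a b)))
    (hbd : ∀ R : ℝ, ∃ bound : ℝ → ℝ, IntervalIntegrable bound volume a b ∧
      ∀ y ∈ uIoc a b, ∀ z ∈ HH, ‖z‖ < R → ‖F z y‖ ≤ bound y)
    (hd : ∀ y ∈ uIoc a b, DifferentiableOn ℂ (fun z => F z y) HH) :
    DifferentiableOn ℂ (fun z => ∫ y in a..b, F z y) HH := by
  intro z0 hz0
  set U : Set ℂ := HH ∩ Metric.ball 0 (‖z0‖ + 1) with hUdef
  have hU : IsOpen U := HH_open.inter Metric.isOpen_ball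
  have hz0U : z0 ∈ U := ⟨hz0, by simp⟩
  obtain ⟨bound, hbi, hb⟩ := hbd (‖z0‖ + 1)
  have key : DifferentiableOn ℂ (fun z => ∫ y in uIoc a b, F z y) U := by
    refine holo_integral hU (intervalIntegrable_iff.mp hbi) (fun z hz => hmeas z hz.1) ?_ ?_
    · refine (ae_restrict_mem measurableSet_uIoc).mono fun y hy z hz => hb y hy z hz.1 ?_
      simpa using hz.2
    · exact (ae_restrict_mem measurableSet_uIoc).mono fun y hy => (hd y hy).mono inter_subset_left
  have h2 := ((key z0 hz0U).differentiableAt (hU.mem_nhds hz0U)).differentiableWithinAt (s := HH)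
  simp only [intervalIntegral.intervalIntegral_eq_integral_uIoc]
  exact h2.const_smul _

/-- Global data on the whole line. -/
structure Core (P P' Q Q' r : ℝ → ℝ) (c : ℝ) : Prop where
  hP : Prim P P'
  hQ : Prim Q Q'
  iP : Integrable P'
  iQ : Integrable Q'
  ir : Integrable r
  c0 : 0 < c
  hc : ∀ x, c ≤ P x

section
variable (P P' Q Q' r : ℝ → ℝ)

/-- square root `s` -/
def sF (z : ℂ) (x : ℝ) : ℂ := ((P x : ℂ) * ((Q x : ℂ) - z)) ^ (1/2 : ℂ)
/-- sigma -/
def sg (z : ℂ) (x : ℝ) : ℂ := (P' x : ℂ) / (4 * P x) + (Q' x : ℂ) / (4 * ((Q x : ℂ) - z))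
/-- rho -/
def rh (z : ℂ) (x : ℝ) : ℂ := (r x : ℂ) / (2 * sF P Q z x)
/-- coefficient alpha -/
def al (z : ℂ) (x : ℝ) : ℂ := rh P Q r z x + sg P P' Q Q' z x
/-- coefficient beta -/
def be (z : ℂ) (x : ℝ) : ℂ := rh P Q r z x - sg P P' Q Q' z x
/-- phase -/
def OmF (z : ℂ) (x : ℝ) : ℂ := ∫ y in (0:ℝ)..x, sF P Q z y / P y
/-- majorant -/
def mF (c d : ℝ) (x : ℝ) : ℝ :=
  |P' x| / (4 * c) + |Q' x| / (4 * d) + |r x| / (2 * Real.sqrt (c * d))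
end

section
variable {P P' Q Q' r : ℝ → ℝ} {c : ℝ}

theorem Core.pos (h : Core P P' Q Q' r c) (x : ℝ) : 0 < P x := h.c0.trans_le (h.hc x)

theorem core_im (h : Core P P' Q Q' r c) {z : ℂ} (hz : z ∈ HH) (x : ℝ) :
    ((P x : ℂ) * ((Q x : ℂ) - z)).im < 0 := by
  have h1 := h.pos x
  have h2 : 0 < z.im := hz
  rw [im_ofReal_mul]
  simp
  positivity

theorem qz_ne {z : ℂ} (hz : z ∈ HH) (t : ℝ) : (t : ℂ) - z ≠ 0 := by
  intro h
  have h1 : ((t : ℂ) - z).im = 0 := by rw [h]; simp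
  have h2 : 0 < z.im := hz
  simp at h1; linarith

theorem qz_norm {z : ℂ} (t : ℝ) : z.im ≤ ‖(t : ℂ) - z‖ := by
  have := abs_im_le_norm ((t : ℂ) - z)
  simp at this
  exact (le_abs_self _).trans this

theorem s_re (h : Core P P' Q Q' r c) {z : ℂ} (hz : z ∈ HH) (x : ℝ) : 0 < (sF P Q z x).re :=
  half_re_pos (slit_of_im (core_im h hz x))

theorem s_ne (h : Core P P' Q Q' r c) {z : ℂ} (hz : z ∈ HH) (x : ℝ) : sF P Q z x ≠ 0 := by
  intro h0; have := s_re h hz x; simp [h0] at this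

theorem s_sq (z : ℂ) (x : ℝ) : sF P Q z x ^ 2 = (P x : ℂ) * ((Q x : ℂ) - z) := half_sq _

theorem s_cont (h : Core P P' Q Q' r c) {z : ℂ} (hz : z ∈ HH) : Continuous (sF P Q z) := by
  have h1 := h.hP.continuous
  have h2 := h.hQ.continuous
  refine Continuous.cpow ?_ continuous_const (fun x => slit_of_im (core_im h hz x))
  fun_prop

theorem s_holo (h : Core P P' Q Q' r c) (x : ℝ) : DifferentiableOn ℂ (fun z => sF P Q z x) HH := by
  refine DifferentiableOn.cpow_const ?_ (fun z hz => slit_of_im (core_im h hz x))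
  fun_prop

theorem s_prim (h : Core P P' Q Q' r c) {z : ℂ} (hz : z ∈ HH) :
    Prim (sF P Q z) (fun x => 2 * sg P P' Q Q' z x * sF P Q z x) := by
  have h1 := h.hP.ofReal.mul (h.hQ.ofReal.sub (Prim.const z))
  refine (h1.sqrt (s_cont h hz) (s_sq z) (s_re h hz)).congr' fun x => ?_
  have h2 := s_ne h hz x
  have h3 := qz_ne hz (Q x)
  have h4 : (P x : ℂ) ≠ 0 := ofReal_ne_zero.mpr (h.pos x).ne'
  have h5 := s_sq (P := P) (Q := Q) z x
  rw [div_eq_iff (by simpa using h2)]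
  have : 2 * sg P P' Q Q' z x * sF P Q z x * (2 * sF P Q z x) =
    4 * sg P P' Q Q' z x * sF P Q z x ^ 2 := by ring
  rw [this, h5, sg]
  field_simp
  ring

theorem om_cont (h : Core P P' Q Q' r c) {z : ℂ} (hz : z ∈ HH) :
    Continuous (fun x => sF P Q z x / P x) :=
  (s_cont h hz).div (continuous_ofReal.comp h.hP.continuous)
    fun x => ofReal_ne_zero.mpr (h.pos x).ne'

theorem Om_prim (h : Core P P' Q Q' r c) {z : ℂ} (hz : z ∈ HH) :
    Prim (OmF P Q z) (fun x => sF P Q z x / P x) :=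
  Prim.of_integral (om_cont h hz).locallyIntegrable 0

theorem Om_deriv (h : Core P P' Q Q' r c) {z : ℂ} (hz : z ∈ HH) (x : ℝ) :
    HasDerivAt (OmF P Q z) (sF P Q z x / P x) x := (Om_prim h hz).hasDerivAt (om_cont h hz) x

theorem Om_holo (h : Core P P' Q Q' r c) (x : ℝ) :
    DifferentiableOn ℂ (fun z => OmF P Q z x) HH := by
  refine holo_interval (fun z hz => (om_cont h hz).aestronglyMeasurable) ?_ ?_
  · intro R
    refine ⟨fun y => (1 + P y * (|Q y| + R)) / P y, Continuous.intervalIntegrable ?_ _ _, ?_⟩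
    · have := h.hP.continuous
      have := h.hQ.continuous
      exact Continuous.div (by fun_prop) (by fun_prop) fun x => (h.pos x).ne'
    · intro y _ z hz hR
      have hp := h.pos y
      rw [norm_div, norm_real, Real.norm_of_nonneg hp.le]
      refine div_le_div_of_nonneg_right ?_ hp.le
      refine (half_norm_le _).trans ?_
      rw [norm_mul, norm_real, Real.norm_of_nonneg hp.le]
      gcongr
      refine (norm_sub_le _ _).trans ?_
      rw [norm_real, Real.norm_eq_abs]
      gcongr
  · intro y _
    exact (s_holo h y).div_const _

theorem sg_holo (y : ℝ) : DifferentiableOn ℂ (fun z => sg P P' Q Q' z y) HH := by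
  unfold sg
  refine (differentiableOn_const _).add ?_
  refine DifferentiableOn.div (differentiableOn_const _) (by fun_prop) fun z hz => ?_
  have := qz_ne hz (Q y)
  simpa using this

theorem rh_holo (h : Core P P' Q Q' r c) (y : ℝ) :
    DifferentiableOn ℂ (fun z => rh P Q r z y) HH := by
  unfold rh
  refine DifferentiableOn.div (differentiableOn_const _) ((s_holo h y).const_mul _) fun z hz => ?_
  have := s_ne h hz y
  simpa using this

theorem sg_le (h : Core P P' Q Q' r c) {d : ℝ} (hd : 0 < d) {z : ℂ} (hz : d < z.im) (y : ℝ) :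
    ‖sg P P' Q Q' z y‖ ≤ |P' y| / (4 * c) + |Q' y| / (4 * d) := by
  have hc := h.c0
  have h1 := h.hc y
  have h2 := (qz_norm (z := z) (Q y))
  refine (norm_add_le _ _).trans ?_
  simp only [norm_div, norm_mul, norm_real, Real.norm_eq_abs, abs_of_pos (h.pos y),
    RCLike.norm_ofNat]
  have h3 : d ≤ ‖(Q y : ℂ) - z‖ := hz.le.trans h2
  gcongr

theorem rh_le (h : Core P P' Q Q' r c) {d : ℝ} (hd : 0 < d) {z : ℂ} (hz : d < z.im) (y : ℝ) :
    ‖rh P Q r z y‖ ≤ |r y| / (2 * Real.sqrt (c * d)) := by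
  have hc := h.c0
  have h1 := h.hc y
  have h2 := (qz_norm (z := z) (Q y))
  have hs : Real.sqrt (c * d) ≤ ‖sF P Q z y‖ := by
    refine Real.sqrt_le_iff.mpr ⟨norm_nonneg _, ?_⟩
    rw [sF, half_norm_sq, norm_mul, norm_real, Real.norm_eq_abs, abs_of_pos (h.pos y)]
    have h3 : d ≤ ‖(Q y : ℂ) - z‖ := hz.le.trans h2
    have h4 := (h.pos y).le
    gcongr
  have : 0 < Real.sqrt (c * d) := Real.sqrt_pos.mpr (by positivity)
  simp only [rh, norm_div, norm_mul, norm_real, Real.norm_eq_abs, RCLike.norm_ofNat]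
  gcongr

theorem core_vhyp (h : Core P P' Q Q' r c) {d : ℝ} (hd : 0 < d) {z : ℂ} (hz : d < z.im) :
    VHyp (al P P' Q Q' r) (be P P' Q Q' r) (OmF P Q) (mF P' Q' r c d) z := by
  have hzH : z ∈ HH := hd.trans hz
  have hcs := s_cont h hzH
  have hrm : AEStronglyMeasurable (rh P Q r z) volume := by
    unfold rh
    simp only [div_eq_mul_inv]
    refine (continuous_ofReal.comp_aestronglyMeasurable h.ir.1).mul
      (Continuous.aestronglyMeasurable ?_)
    exact (continuous_const.mul hcs).inv₀ fun x => by simpa using s_ne h hzH x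
  have hsm : AEStronglyMeasurable (sg P P' Q Q' z) volume := by
    unfold sg
    simp only [div_eq_mul_inv]
    have h1 := h.hP.continuous
    have h2 := h.hQ.continuous
    refine AEStronglyMeasurable.add ?_ ?_
    · refine (continuous_ofReal.comp_aestronglyMeasurable h.iP.1).mul
        (Continuous.aestronglyMeasurable ?_)
      exact Continuous.inv₀ (by fun_prop) fun x => by simpa using (h.pos x).ne'
    · refine (continuous_ofReal.comp_aestronglyMeasurable h.iQ.1).mul
        (Continuous.aestronglyMeasurable ?_)
      exact Continuous.inv₀ (by fun_prop) fun x => by simpa using qz_ne hzH (Q x)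
  have hle : ∀ y, ‖rh P Q r z y‖ + ‖sg P P' Q Q' z y‖ ≤ mF P' Q' r c d y := by
    intro y
    have := sg_le h hd hz y
    have := rh_le h hd hz y
    unfold mF; linarith
  refine ⟨?_, hrm.add hsm, hrm.sub hsm, fun y => (norm_add_le _ _).trans (hle y),
    fun y => (norm_sub_le _ _).trans (hle y), (Om_prim h hzH).continuous, ?_⟩
  · exact ((h.iP.abs.div_const _).add (h.iQ.abs.div_const _)).add (h.ir.abs.div_const _)
  · intro x y hxy
    have hm : Monotone (fun x => (OmF P Q z x).re) := by
      have hd : ∀ x, HasDerivAt (fun x => (OmF P Q z x).re) ((sF P Q z x / P x).re) x :=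
        fun x => reCLM.hasFDerivAt.comp_hasDerivAt x (Om_deriv h hzH x)
      refine monotone_of_deriv_nonneg (fun x => (hd x).differentiableAt) fun x => ?_
      rw [(hd x).deriv, div_ofReal_re]
      exact div_nonneg (s_re h hzH x).le (h.pos x).le
    exact hm hxy

/-- First component. -/
def UF (P P' Q Q' r : ℝ → ℝ) : ℂ → ℝ → ℂ := US (al P P' Q Q' r) (be P P' Q Q' r) (OmF P Q)
/-- Second component. -/
def VF (P P' Q Q' r : ℝ → ℝ) : ℂ → ℝ → ℂ := VS (al P P' Q Q' r) (be P P' Q Q' r) (OmF P Q)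
/-- The solution. -/
def fF (P P' Q Q' r : ℝ → ℝ) (z : ℂ) (x : ℝ) : ℂ :=
  cexp (- OmF P Q z x) * (UF P P' Q Q' r z x + VF P P' Q Q' r z x)
/-- The difference. -/
def DF (P P' Q Q' r : ℝ → ℝ) (z : ℂ) (x : ℝ) : ℂ :=
  cexp (- OmF P Q z x) * (VF P P' Q Q' r z x - UF P P' Q Q' r z x)

theorem core_vhyp' (h : Core P P' Q Q' r c) {z : ℂ} (hz : z ∈ HH) :
    VHyp (al P P' Q Q' r) (be P P' Q Q' r) (OmF P Q) (mF P' Q' r c (z.im / 2)) z := by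
  have h0 : 0 < z.im := hz
  exact core_vhyp h (d := z.im / 2) (by linarith) (by linarith)

theorem fF_holo (h : Core P P' Q Q' r c) (x : ℝ) :
    DifferentiableOn ℂ (fun z => fF P P' Q Q' r z x) HH := by
  have huv : DifferentiableOn ℂ (fun z => UF P P' Q Q' r z x) HH ∧
      DifferentiableOn ℂ (fun z => VF P P' Q Q' r z x) HH := by
    have : ∀ z0 ∈ HH, DifferentiableAt ℂ (fun z => UF P P' Q Q' r z x) z0 ∧
        DifferentiableAt ℂ (fun z => VF P P' Q Q' r z x) z0 := by
      intro z0 hz0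
      have h0 : 0 < z0.im := hz0
      have hU : IsOpen {z : ℂ | z0.im / 2 < z.im} := isOpen_lt continuous_const continuous_im
      have hsub : {z : ℂ | z0.im / 2 < z.im} ⊆ HH := fun z (hz : z0.im / 2 < z.im) => by
        change 0 < z.im; linarith
      have hmem : {z : ℂ | z0.im / 2 < z.im} ∈ nhds z0 :=
        hU.mem_nhds (by change z0.im / 2 < z0.im; linarith)
      have := UVS_holo hU (fun z hz => core_vhyp h (d := z0.im / 2) (by linarith) hz)
        (fun y => ((rh_holo h y).add (sg_holo y)).mono hsub)
        (fun y => ((rh_holo h y).sub (sg_holo y)).mono hsub)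
        (fun y => (Om_holo h y).mono hsub) x
      exact ⟨this.1.differentiableAt hmem, this.2.differentiableAt hmem⟩
    exact ⟨fun z hz => (this z hz).1.differentiableWithinAt,
      fun z hz => (this z hz).2.differentiableWithinAt⟩
  exact ((Om_holo h x).neg.cexp).mul (huv.1.add huv.2)

theorem f_lim (h : Core P P' Q Q' r c) {z : ℂ} (hz : z ∈ HH) :
    Tendsto (fun x => UF P P' Q Q' r z x + VF P P' Q Q' r z x) atTop (nhds 1) := by
  have h1 := (US_lim (core_vhyp' h hz)).add (VS_lim (core_vhyp' h hz))
  rw [add_zero] at h1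
  exact h1

theorem exp_prim (h : Core P P' Q Q' r c) {z : ℂ} (hz : z ∈ HH) (k : ℂ) :
    Prim (fun x => cexp (k * OmF P Q z x))
      (fun x => cexp (k * OmF P Q z x) * (k * (sF P Q z x / P x))) := by
  refine Prim.of_deriv ?_ fun x => ((Om_deriv h hz x).const_mul k).cexp
  have := om_cont h hz
  have := (Om_prim h hz).continuous
  fun_prop

theorem aU_prim (h : Core P P' Q Q' r c) {z : ℂ} (hz : z ∈ HH) :
    Prim (fun x => cexp (- OmF P Q z x) * UF P P' Q Q' r z x)
      (fun x => cexp (- OmF P Q z x) * (- (sF P Q z x / P x) * UF P P' Q Q' r z x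
        - WS (al P P' Q Q' r) (be P P' Q Q' r) (OmF P Q) z x)) := by
  have h1 := (exp_prim h hz (-1)).mul (US_prim (core_vhyp' h hz))
  simp only [neg_mul, one_mul] at h1
  refine h1.congr' fun x => ?_
  unfold UF
  ring

theorem aV_prim (h : Core P P' Q Q' r c) {z : ℂ} (hz : z ∈ HH) :
    Prim (fun x => cexp (- OmF P Q z x) * VF P P' Q Q' r z x)
      (fun x => cexp (- OmF P Q z x) * ((sF P Q z x / P x) * VF P P' Q Q' r z x
        + WS (al P P' Q Q' r) (be P P' Q Q' r) (OmF P Q) z x)) := by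
  have h1 := (exp_prim h hz 1).mul (VS_prim (core_vhyp' h hz))
  have e : ∀ x, cexp (- OmF P Q z x) = cexp (1 * OmF P Q z x) * cexp (-2 * OmF P Q z x) := by
    intro x; rw [← exp_add]; congr 1; ring
  simp only [e]
  unfold VF
  simp only [← mul_assoc] at h1 ⊢
  refine h1.congr' fun x => ?_
  ring

theorem f_prim (h : Core P P' Q Q' r c) {z : ℂ} (hz : z ∈ HH) :
    Prim (fF P P' Q Q' r z) (fun x => (sF P Q z x / P x) * DF P P' Q Q' r z x) := by
  have h1 := (aU_prim h hz).add (aV_prim h hz)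
  simp only [← mul_add] at h1
  refine h1.congr' fun x => ?_
  unfold DF; ring

theorem D_prim (h : Core P P' Q Q' r c) {z : ℂ} (hz : z ∈ HH) :
    Prim (DF P P' Q Q' r z) (fun x => (sF P Q z x / P x) * fF P P' Q Q' r z x
      + 2 * cexp (- OmF P Q z x) * WS (al P P' Q Q' r) (be P P' Q Q' r) (OmF P Q) z x) := by
  have h1 := (aV_prim h hz).sub (aU_prim h hz)
  simp only [← mul_sub] at h1
  refine h1.congr' fun x => ?_
  unfold fF; ring

theorem f_deriv (h : Core P P' Q Q' r c) {z : ℂ} (hz : z ∈ HH) (x : ℝ) :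
    HasDerivAt (fF P P' Q Q' r z) ((sF P Q z x / P x) * DF P P' Q Q' r z x) x :=
  (f_prim h hz).hasDerivAt ((om_cont h hz).mul (D_prim h hz).continuous) x

theorem sD_prim (h : Core P P' Q Q' r c) {z : ℂ} (hz : z ∈ HH) :
    Prim (fun x => sF P Q z x * DF P P' Q Q' r z x)
      (fun x => ((Q x : ℂ) + r x - z) * fF P P' Q Q' r z x) := by
  refine ((s_prim h hz).mul (D_prim h hz)).congr' fun x => ?_
  have h2 := s_ne h hz x
  have h4 : (P x : ℂ) ≠ 0 := ofReal_ne_zero.mpr (h.pos x).ne'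
  have h5 := s_sq (P := P) (Q := Q) z x
  have e1 : sF P Q z x * (sF P Q z x / P x) = (Q x : ℂ) - z := by
    rw [mul_div_assoc', ← sq, h5]; field_simp
  have e2 : 2 * sF P Q z x * rh P Q r z x = r x := by
    unfold rh; field_simp
  have e3 : WS (al P P' Q Q' r) (be P P' Q Q' r) (OmF P Q) z x =
      rh P Q r z x * (UF P P' Q Q' r z x + VF P P' Q Q' r z x)
      - sg P P' Q Q' z x * (VF P P' Q Q' r z x - UF P P' Q Q' r z x) := by
    change al P P' Q Q' r z x * UF P P' Q Q' r z x + be P P' Q Q' r z x * VF P P' Q Q' r z x = _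
    have ea : al P P' Q Q' r z x = rh P Q r z x + sg P P' Q Q' z x := rfl
    have eb : be P P' Q Q' r z x = rh P Q r z x - sg P P' Q Q' z x := rfl
    rw [ea, eb]; ring
  rw [e3]
  have e4 : ((Q x : ℂ) + r x - z) = sF P Q z x * (sF P Q z x / P x) +
    2 * sF P Q z x * rh P Q r z x := by rw [e1, e2]; ring
  rw [e4]
  unfold fF DF
  ring
end


section
variable {P P' Q Q' r : ℝ → ℝ} {c : ℝ}

theorem oT_meas (h : Core P P' Q Q' r c) (z : ℂ) :
    AEStronglyMeasurable (omg P (fun y => Q y + r y) z) volume := by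
  have h1 := h.hP.continuous.measurable
  have h2 := h.hQ.continuous.measurable
  have h3 := h.ir.1.aemeasurable
  refine AEMeasurable.aestronglyMeasurable ?_
  unfold omg
  refine AEMeasurable.pow_const ?_ _
  fun_prop

theorem oT_le (h : Core P P' Q Q' r c) {z : ℂ} {R : ℝ} (hR : ‖z‖ ≤ R) (y : ℝ) :
    ‖omg P (fun y => Q y + r y) z y‖ ≤ 1 + (|Q y| + |r y| + R) / c := by
  have hc := h.c0
  have hp := h.hc y
  have hR0 : 0 ≤ R := (norm_nonneg z).trans hR
  refine (half_norm_le _).trans ?_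
  rw [norm_div, norm_real, Real.norm_of_nonneg (h.pos y).le]
  gcongr
  refine (norm_sub_le _ _).trans ?_
  rw [norm_real, Real.norm_eq_abs]
  have := abs_add_le (Q y) (r y)
  linarith

theorem bd_ii (h : Core P P' Q Q' r c) (R a b : ℝ) :
    IntervalIntegrable (fun y => 1 + (|Q y| + |r y| + R) / c) volume a b := by
  have h1 : IntervalIntegrable (fun y => |Q y|) volume a b :=
    (continuous_abs.comp h.hQ.continuous).intervalIntegrable _ _
  have h2 : IntervalIntegrable (fun y => |r y|) volume a b := h.ir.abs.intervalIntegrable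
  have h3 : IntervalIntegrable (fun y : ℝ => R) volume a b := intervalIntegrable_const
  have h4 : IntervalIntegrable (fun y : ℝ => (1:ℝ)) volume a b := intervalIntegrable_const
  exact h4.add (((h1.add h2).add h3).div_const c)

theorem oT_ii (h : Core P P' Q Q' r c) (z : ℂ) (a b : ℝ) :
    IntervalIntegrable (omg P (fun y => Q y + r y) z) volume a b := by
  refine (bd_ii h ‖z‖ a b).mono_fun (oT_meas h z).restrict ?_
  refine Eventually.of_forall fun y => ?_
  exact (oT_le h le_rfl y).trans (le_abs_self _)

theorem oT_im (h : Core P P' Q Q' r c) {z : ℂ} (hz : z ∈ HH) (t y : ℝ) :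
    (((t : ℂ) - z) / (P y : ℂ)).im < 0 := by
  have h1 := h.pos y
  have h2 : 0 < z.im := hz
  rw [div_ofReal_im]
  refine div_neg_of_neg_of_pos ?_ h1
  simpa using h2

theorem oT_holo (h : Core P P' Q Q' r c) (a b : ℝ) :
    DifferentiableOn ℂ (fun z => ∫ y in a..b, omg P (fun y => Q y + r y) z y) HH := by
  refine holo_interval (fun z hz => (oT_meas h z).restrict) ?_ ?_
  · intro R
    exact ⟨_, bd_ii h R a b, fun y _ z hz hR => oT_le h hR.le y⟩
  · intro y _
    unfold omg
    refine DifferentiableOn.cpow_const ?_ (fun z hz => slit_of_im (oT_im h hz _ y))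
    fun_prop

theorem oT_eq (h : Core P P' Q Q' r c) {z : ℂ} (hz : z ∈ HH) {y : ℝ} (hr : r y = 0) :
    omg P (fun y => Q y + r y) z y = sF P Q z y / P y := by
  have hp := h.pos y
  have h4 : (P y : ℂ) ≠ 0 := ofReal_ne_zero.mpr hp.ne'
  refine eq_of_sq_re ?_ (half_re_pos (slit_of_im (oT_im h hz _ y))) ?_
  · rw [omg, half_sq, div_pow, s_sq, hr]
    field_simp
    simp
  · rw [div_ofReal_re]
    exact div_pos (s_re h hz y) hp

end

theorem clamp_prim {f f' : ℝ → ℝ} {x₀ : ℝ} (hf : ∀ x, x₀ ≤ x → f x = f x₀ + ∫ t in x₀..x, f' t)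
    (hi : IntegrableOn f' (Ioi x₀)) :
    Prim (fun x => f (max x x₀)) (indicator (Ioi x₀) f') := by
  have hInt0 : Integrable (indicator (Ioi x₀) f') := (integrable_indicator_iff measurableSet_Ioi).mpr hi
  have key : ∀ x, f (max x x₀) = f x₀ + ∫ t in x₀..x, indicator (Ioi x₀) f' t := by
    intro x
    rcases le_total x₀ x with h | h
    · rw [max_eq_left h, hf x h]
      congr 1
      refine intervalIntegral.integral_congr_ae (Eventually.of_forall fun t ht => ?_)
      rw [uIoc_of_le h] at ht
      rw [indicator_of_mem (show t ∈ Ioi x₀ from ht.1)]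
    · rw [max_eq_right h]
      have : ∫ t in x₀..x, indicator (Ioi x₀) f' t = ∫ t in x₀..x, (0:ℝ) := by
        refine intervalIntegral.integral_congr_ae (Eventually.of_forall fun t ht => ?_)
        rw [uIoc_of_ge h] at ht
        rw [indicator_of_notMem (show t ∉ Ioi x₀ from not_lt.mpr ht.2)]
      rw [this]; simp
  refine ⟨hInt0.locallyIntegrable, fun a b => ?_⟩
  have := intervalIntegral.integral_add_adjacent_intervals
    (hInt0.intervalIntegrable (a := x₀) (b := a)) (hInt0.intervalIntegrable (a := a) (b := b))
  simp only [key]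
  linarith

theorem clamp_lower {f f' : ℝ → ℝ} {p₀ : ℝ} (hP : Continuous (fun x : ℝ => f (max x 0)))
    (hpos : ∀ x, 0 ≤ x → 0 < f x) (h0 : 0 < p₀) (hl : Tendsto f atTop (nhds p₀)) :
    ∃ c, 0 < c ∧ ∀ x, c ≤ f (max x 0) := by
  have h1 : ∀ᶠ x in atTop, p₀ / 2 < f x := hl.eventually (lt_mem_nhds (by linarith))
  obtain ⟨X, hX⟩ := eventually_atTop.mp h1
  obtain ⟨m, hm, hmin⟩ := isCompact_Icc.exists_isMinOn (s := Icc 0 (max X 0))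
    ⟨0, by simp⟩ hP.continuousOn
  refine ⟨min (p₀ / 2) (f (max m 0)), lt_min (by linarith) (hpos _ (le_max_right _ _)), fun x => ?_⟩
  rcases le_total X (max x 0) with h | h
  · exact (min_le_left _ _).trans (hX _ h).le
  · refine (min_le_right _ _).trans ?_
    have := hmin (a := max x 0) ⟨le_max_right _ _, h.trans (le_max_left _ _)⟩
    simpa using this

theorem core_of_PQ {p p' q q' : ℝ → ℝ} {p₀ x₀ : ℝ} (hPQ : PQData p p' q q' p₀ x₀) :
    ∃ (P P' Q Q' r : ℝ → ℝ) (c : ℝ), Core P P' Q Q' r c ∧ (∀ x, 0 ≤ x → p x = P x) ∧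
      (∀ x, 0 < x → q x = Q x + r x) ∧ (∀ x, x₀ ≤ x → r x = 0) := by
  have hP := clamp_prim hPQ.p_ac hPQ.p'_int
  have hQ := clamp_prim hPQ.q_ac hPQ.q'_int
  obtain ⟨c, hc0, hc⟩ := clamp_lower (f' := p') hP.continuous hPQ.p_pos hPQ.hp₀ hPQ.p_lim
  refine ⟨_, _, _, _, indicator (Ioo 0 x₀) (fun x => q x - q x₀), c,
    ⟨hP, hQ, ?_, ?_, ?_, hc0, hc⟩, ?_, ?_, ?_⟩
  · exact (integrable_indicator_iff measurableSet_Ioi).mpr hPQ.p'_int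
  · exact (integrable_indicator_iff measurableSet_Ioi).mpr hPQ.q'_int
  · refine (integrable_indicator_iff measurableSet_Ioo).mpr (hPQ.q_int.sub ?_)
    exact integrableOn_const (by simp)
  · intro x hx
    simp [hx]
  · intro x hx
    rcases lt_or_ge x x₀ with h | h
    · rw [indicator_of_mem (show x ∈ Ioo 0 x₀ from ⟨hx, h⟩)]
      simp [max_eq_right h.le]
    · rw [indicator_of_notMem (fun h' => not_lt.mpr h h'.2)]
      simp [max_eq_left h]
  · intro x hx
    exact indicator_of_notMem (fun h' => not_lt.mpr hx h'.2) _

/-- there is a family `θ(x,z)` such that for each `z` in the open upper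
half-plane, `θ(·,z)` solves the Schrödinger equation on `[0,∞)` with
`θ(x,z)/a(x,z) → 1` as `x → ∞`, and for each `x ≥ 0` the map `z ↦ θ(x,z)` is
holomorphic on `{Im z > 0}`. -/
theorem statement10 (p p' q q' : ℝ → ℝ) (p₀ x₀ : ℝ)
    (hPQ : PQData p p' q q' p₀ x₀) :
    ∃ θ : ℝ → ℂ → ℂ,
      (∀ z : ℂ, 0 < z.im →
        (∃ θ' : ℝ → ℂ, IsSol p q z (Ici 0) (fun x => θ x z) θ') ∧
        Tendsto (fun x => θ x z / aa p q z x) atTop (nhds 1)) ∧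
      (∀ x : ℝ, 0 ≤ x → DifferentiableOn ℂ (θ x) {z : ℂ | 0 < z.im}) := by
  obtain ⟨P, P', Q, Q', r, c, h, hp, hq, hr⟩ := core_of_PQ hPQ
  have hx0 := hPQ.hx₀
  have hOm : ∀ z x, 0 ≤ x → Omg p q z x = ∫ y in (0:ℝ)..x, omg P (fun y => Q y + r y) z y := by
    intro z x hx
    refine intervalIntegral.integral_congr_ae (Eventually.of_forall fun t ht => ?_)
    rw [uIoc_of_le hx] at ht
    simp only [omg]
    rw [hp t ht.1.le, hq t ht.1]
  refine ⟨fun x z => cexp (OmF P Q z x₀ - Omg p q z x₀) * fF P P' Q Q' r z x, ?_, ?_⟩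
  · intro z hz
    have hzH : z ∈ HH := hz
    refine ⟨⟨fun x => cexp (OmF P Q z x₀ - Omg p q z x₀) *
      ((sF P Q z x / P x) * DF P P' Q Q' r z x), ?_, ?_⟩, ?_⟩
    · intro x _
      exact ((f_deriv h hzH x).const_mul _).hasDerivWithinAt
    · intro x hx y hy
      have hx' : 0 ≤ x := hx
      have hy' : 0 ≤ y := hy
      have e : ∀ t, 0 ≤ t → (p t : ℂ) * (cexp (OmF P Q z x₀ - Omg p q z x₀) *
          ((sF P Q z t / P t) * DF P P' Q Q' r z t)) =
          cexp (OmF P Q z x₀ - Omg p q z x₀) * (sF P Q z t * DF P P' Q Q' r z t) := by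
        intro t ht
        have h4 : (P t : ℂ) ≠ 0 := ofReal_ne_zero.mpr (h.pos t).ne'
        rw [hp t ht]
        field_simp
      rw [e x hx', e y hy', ← mul_sub, (sD_prim h hzH).ftc x y,
        ← intervalIntegral.integral_const_mul]
      refine intervalIntegral.integral_congr_ae (Eventually.of_forall fun t ht => ?_)
      have ht0 : 0 < t := (le_min hx' hy').trans_lt ht.1
      simp only [hq t ht0]
      push_cast
      ring
    · refine (f_lim h hzH).congr' ?_
      filter_upwards [eventually_ge_atTop x₀] with x hx
      have e1 : Omg p q z x = Omg p q z x₀ + (OmF P Q z x - OmF P Q z x₀) := by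
        rw [hOm z x (hx0.trans hx), hOm z x₀ hx0, (Om_prim h hzH).ftc x₀ x,
          ← intervalIntegral.integral_add_adjacent_intervals (oT_ii h z 0 x₀) (oT_ii h z x₀ x)]
        congr 1
        refine intervalIntegral.integral_congr_ae (Eventually.of_forall fun t ht => ?_)
        rw [uIoc_of_le hx] at ht
        exact oT_eq h hzH (hr t ht.1.le)
      rw [aa, eq_div_iff (exp_ne_zero _), e1, fF, ← mul_assoc, ← exp_add, mul_comm]
      congr 2
      ring
  · intro x _
    have h1 : DifferentiableOn ℂ (fun z => Omg p q z x₀) HH := by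
      simp only [fun z => hOm z x₀ hx0]
      exact oT_holo h 0 x₀
    exact (((Om_holo h x₀).sub h1).cexp).mul (fF_holo h x)

end
end
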